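/- arXiv:1512.07023 — 2 statements merged into one kernel-verified Lean document; each statement's English description precedes it below -/
import Mathlib

section
/- (Mollification with small jump set) There is $c>0$ (depending on $p$ and the chosen mollifier) such that for $u\in SBV^p(Q_r)$ with jumps of normal $e_2$ and $\mathcal{H}^1(J_u\cap Q_r)\le\rho$, $0<\rho<r$, one has $\|\nabla(u*\varphi_\rho)\|_{L^p(Q_{r-\rho})}\le\big(1+c\,(\mathcal{H}^1(J_u\cap Q_r)/\rho)^{1/p'}\big)\,\|\nabla u\|_{L^p(Q_r)}$, where $p'=p/(p-1)$. -/
open MeasureTheory Set Filter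
open scoped ENNReal Topology

/-- Convolution `f * φ`. -/
noncomputable def conv (f φ : ℝ × ℝ → ℝ) (x : ℝ × ℝ) : ℝ :=
  ∫ y, f y * φ (x - y)

/-- The open square of center `z` and half side `s`. -/
def sqC (z : ℝ × ℝ) (s : ℝ) : Set (ℝ × ℝ) :=
  Set.Ioo (z.1 - s) (z.1 + s) ×ˢ Set.Ioo (z.2 - s) (z.2 + s)

lemma ibp_aux {a b : ℝ} (hab : a ≤ b) {v w η e : ℝ → ℝ}
    (hw : IntegrableOn w (Ioo a b))
    (hv : ∀ s ∈ Icc a b, v s - v a = ∫ t in a..s, w t)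
    (hη : ∀ s, HasDerivAt η (e s) s) (he : Continuous e)
    (ha : η a = 0) (hb : η b = 0) :
    ∫ s in Ioo a b, v s * e s = - ∫ s in Ioo a b, w s * η s := by
  have hwi : IntervalIntegrable w volume a b := by
    rw [intervalIntegrable_iff_integrableOn_Ioo_of_le hab]; exact hw
  have hae : (deriv η) = e := funext fun s => (hη s).deriv
  have hηc : ContDiff ℝ 1 η := by
    rw [contDiff_one_iff_deriv]
    exact ⟨fun s => (hη s).differentiableAt, by rw [hae]; exact he⟩
  have h1 := hwi.absolutelyContinuousOnInterval_intervalIntegral (c := a) left_mem_uIcc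
  have h2 : AbsolutelyContinuousOnInterval η a b :=
    hηc.contDiffOn.absolutelyContinuousOnInterval
  have h3 := h1.integral_mul_deriv_eq_deriv_mul h2
  have h4 : ∫ x in a..b, deriv (fun x => ∫ t in a..x, w t) x * η x = ∫ x in a..b, w x * η x := by
    apply intervalIntegral.integral_congr_ae
    filter_upwards [hwi.ae_hasDerivAt_integral] with x hx hx'
    rw [(hx (uIoc_subset_uIcc hx') a left_mem_uIcc).deriv]
  have h5 : ∫ x in a..b, e x = 0 := by
    rw [intervalIntegral.integral_eq_sub_of_hasDerivAt (fun x _ => hη x)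
      (he.intervalIntegrable _ _), ha, hb, sub_zero]
  have h6 : ∫ x in a..b, v x * e x = ∫ x in a..b, (v a * e x + (∫ t in a..x, w t) * e x) := by
    apply intervalIntegral.integral_congr
    intro x hx
    rw [uIcc_of_le hab] at hx
    have := hv x hx
    simp only
    rw [← this]; ring
  rw [← integral_Ioc_eq_integral_Ioo, ← integral_Ioc_eq_integral_Ioo,
    ← intervalIntegral.integral_of_le hab, ← intervalIntegral.integral_of_le hab, h6,
    intervalIntegral.integral_add ((he.intervalIntegrable _ _).const_mul _)
      (ContinuousOn.intervalIntegrable (h1.continuousOn.fun_mul he.continuousOn)),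
    intervalIntegral.integral_const_mul, h5]
  rw [hae, h4, ha, hb] at h3
  rw [h3]; ring

lemma young_aux {p : ℝ} (hp : 1 < p) {f k : ℝ × ℝ → ℝ≥0∞} (hf : Measurable f) (hk : Measurable k) :
    ∫⁻ x, (∫⁻ y, f y * k (x - y)) ^ p ≤ (∫⁻ z, k z) ^ p * ∫⁻ y, f y ^ p := by
  have hp0 : 0 < p := by linarith
  have hpq := Real.HolderConjugate.conjExponent hp
  set q := p.conjExponent with hq
  have hq0 : 0 < q := hpq.symm.pos
  have hsub : ∀ x : ℝ × ℝ, ∫⁻ y, k (x - y) = ∫⁻ z, k z := fun x => lintegral_sub_left_eq_self k x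
  have key : ∀ x, (∫⁻ y, f y * k (x - y)) ^ p
      ≤ (∫⁻ y, f y ^ p * k (x - y)) * (∫⁻ z, k z) ^ (p - 1) := by
    intro x
    have hkx : Measurable fun y => k (x - y) := hk.comp (measurable_const.sub measurable_id)
    have h := ENNReal.lintegral_mul_le_Lp_mul_Lq volume hpq
      (f := fun y => f y * k (x - y) ^ (1 / p)) (g := fun y => k (x - y) ^ (1 / q))
      (hf.mul (hkx.pow_const _)).aemeasurable (hkx.pow_const _).aemeasurable
    have e1 : ∀ y, ((fun y => f y * k (x - y) ^ (1 / p)) * fun y => k (x - y) ^ (1 / q)) y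
        = f y * k (x - y) := by
      intro y
      simp only [Pi.mul_apply]
      rw [mul_assoc, ← ENNReal.rpow_add_of_nonneg _ _ (by positivity) (by positivity)]
      have : 1 / p + 1 / q = 1 := by simpa using hpq.inv_add_inv_eq_one
      rw [this, ENNReal.rpow_one]
    have e2 : ∀ y, (f y * k (x - y) ^ (1 / p)) ^ p = f y ^ p * k (x - y) := by
      intro y
      rw [ENNReal.mul_rpow_of_nonneg _ _ hp0.le, ← ENNReal.rpow_mul, one_div,
        inv_mul_cancel₀ hp0.ne', ENNReal.rpow_one]
    have e3 : ∀ y, (k (x - y) ^ (1 / q)) ^ q = k (x - y) := by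
      intro y
      rw [← ENNReal.rpow_mul, one_div, inv_mul_cancel₀ hq0.ne', ENNReal.rpow_one]
    simp only [e1, e2, e3, hsub] at h
    calc _ ≤ _ := ENNReal.rpow_le_rpow h hp0.le
      _ = _ := by
        rw [ENNReal.mul_rpow_of_nonneg _ _ hp0.le, ← ENNReal.rpow_mul, ← ENNReal.rpow_mul, one_div,
          inv_mul_cancel₀ hp0.ne', ENNReal.rpow_one]
        congr 2
        rw [hq, Real.conjExponent]; field_simp
  have hm : Measurable (fun z : (ℝ × ℝ) × (ℝ × ℝ) => f z.2 ^ p * k (z.1 - z.2)) :=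
    ((hf.comp measurable_snd).pow_const p).mul (hk.comp (measurable_fst.sub measurable_snd))
  calc _ ≤ ∫⁻ x, (∫⁻ y, f y ^ p * k (x - y)) * (∫⁻ z, k z) ^ (p - 1) := lintegral_mono key
    _ = (∫⁻ x, ∫⁻ y, f y ^ p * k (x - y)) * (∫⁻ z, k z) ^ (p - 1) :=
        lintegral_mul_const _ hm.lintegral_prod_right'
    _ = (∫⁻ y, ∫⁻ x, f y ^ p * k (x - y)) * (∫⁻ z, k z) ^ (p - 1) := by
        rw [lintegral_lintegral_swap hm.aemeasurable]
    _ = (∫⁻ y, f y ^ p * ∫⁻ z, k z) * (∫⁻ z, k z) ^ (p - 1) := by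
        congr 2; ext y
        have hky : Measurable fun x => k (x - y) := hk.comp (measurable_id.sub_const y)
        rw [lintegral_const_mul _ hky,
          lintegral_sub_right_eq_self k y]
    _ = _ := by
        rw [lintegral_mul_const _ (hf.pow_const p), mul_assoc, mul_comm]
        congr 1
        nth_rewrite 1 [← ENNReal.rpow_one (∫⁻ z, k z)]
        rw [← ENNReal.rpow_add_of_nonneg _ _ zero_le_one (by linarith)]
        congr 1; ring

lemma slice_bound {a1 b1 ρ K : ℝ} {ν : Measure ℝ} [SFinite ν] (hρ : 0 < ρ)
    (h1 : b1 = a1 + 2 * ρ) (hK : 0 ≤ K)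
    {B : Set ℝ} (hBm : MeasurableSet B) (hB : volume B ≤ ENNReal.ofReal ρ)
    {g2 : ℝ × ℝ → ℝ} (hg2 : Integrable g2 ((volume.restrict (Ioo a1 b1)).prod ν)) {X Y : ℝ}
    (h : ∀ᵐ t ∂(volume.restrict (Ioo a1 b1)), t ∉ B → X ≤ K * ρ * (∫ y, ‖g2 (t, y)‖ ∂ν) + Y) :
    X ≤ K * (∫ z, ‖g2 z‖ ∂((volume.restrict (Ioo a1 b1)).prod ν)) + Y := by
  set μ := volume.restrict (Ioo a1 b1) with hμ
  have hfin : IsFiniteMeasure μ := by rw [hμ]; infer_instance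
  have hI : Integrable (fun t => ∫ y, ‖g2 (t, y)‖ ∂ν) μ := hg2.integral_norm_prod_left
  have hfub : ∫ z, ‖g2 z‖ ∂(μ.prod ν) = ∫ t, ∫ y, ‖g2 (t, y)‖ ∂ν ∂μ :=
    integral_prod _ hg2.norm
  have hnn : 0 ≤ ∫ z, ‖g2 z‖ ∂(μ.prod ν) := integral_nonneg fun _ => norm_nonneg _
  by_contra hcon
  push Not at hcon
  have hpos : 0 < X - Y := by
    have := mul_nonneg hK hnn
    linarith
  have hle : ∫ t in Bᶜ, (X - Y) ∂μ ≤ ∫ t in Bᶜ, K * ρ * (∫ y, ‖g2 (t, y)‖ ∂ν) ∂μ := by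
    apply setIntegral_mono_on_ae
    · exact (integrable_const (X - Y)).integrableOn
    · exact (hI.const_mul _).integrableOn
    · exact hBm.compl
    · filter_upwards [h] with t ht htB
      linarith [ht htB]
  have hle2 : ∫ t in Bᶜ, K * ρ * (∫ y, ‖g2 (t, y)‖ ∂ν) ∂μ
      ≤ K * ρ * ∫ z, ‖g2 z‖ ∂(μ.prod ν) := by
    rw [integral_const_mul, hfub]
    apply mul_le_mul_of_nonneg_left _ (by positivity)
    exact setIntegral_le_integral hI (Eventually.of_forall fun _ =>
      integral_nonneg fun _ => norm_nonneg _)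
  have hmeas : ρ ≤ μ.real Bᶜ := by
    have hBμ : μ.real B ≤ ρ := by
      refine ENNReal.toReal_le_of_le_ofReal hρ.le (le_trans ?_ hB)
      exact Measure.restrict_apply_le _ _
    have huniv : μ.real univ = 2 * ρ := by
      simp [hμ, measureReal_def, h1]; linarith
    have : μ.real B + μ.real Bᶜ = μ.real univ := measureReal_add_measureReal_compl hBm
    linarith
  rw [setIntegral_const, smul_eq_mul] at hle
  have : ρ * (X - Y) ≤ ρ * (K * ∫ z, ‖g2 z‖ ∂(μ.prod ν)) := by
    calc _ ≤ μ.real Bᶜ * (X - Y) := mul_le_mul_of_nonneg_right hmeas hpos.le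
      _ ≤ _ := hle.trans hle2
      _ = _ := by ring
  have := le_of_mul_le_mul_left this hρ
  linarith

lemma sqrt_le_of_dir {A1 A2 C : ℝ} (hC : 0 ≤ C)
    (h : ∀ a b : ℝ, a ^ 2 + b ^ 2 = 1 → a * A1 + b * A2 ≤ C) :
    Real.sqrt (A1 ^ 2 + A2 ^ 2) ≤ C := by
  set N := Real.sqrt (A1 ^ 2 + A2 ^ 2) with hN
  have hN2 : N ^ 2 = A1 ^ 2 + A2 ^ 2 := Real.sq_sqrt (by positivity)
  rcases (Real.sqrt_nonneg (A1 ^ 2 + A2 ^ 2)).eq_or_lt with h0 | h0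
  · rw [hN, ← h0]; exact hC
  · rw [← hN] at h0
    have := h (A1 / N) (A2 / N) (by field_simp; linarith)
    have e : A1 / N * A1 + A2 / N * A2 = N := by field_simp; linarith
    linarith

lemma local_aux {a1 b1 a2 b2 ρ K : ℝ} (hρ : 0 < ρ) (h1 : b1 = a1 + 2 * ρ) (h2 : a2 < b2)
    (hK : 0 ≤ K) {u g1 g2 η e1 e2 : ℝ × ℝ → ℝ}
    {B : Set ℝ} (hBm : MeasurableSet B) (hB : volume B ≤ ENNReal.ofReal ρ)
    {μ1 μ2 : Measure ℝ} (hμ1 : μ1 = volume.restrict (Ioo a1 b1))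
    (hμ2 : μ2 = volume.restrict (Ioo a2 b2))
    (hu : Integrable u (μ1.prod μ2)) (hg1 : Integrable g1 (μ1.prod μ2))
    (hg2 : Integrable g2 (μ1.prod μ2))
    (hη1 : ∀ y1 y2, HasDerivAt (fun s => η (s, y2)) (e1 (y1, y2)) y1)
    (hη2 : ∀ y1 y2, HasDerivAt (fun s => η (y1, s)) (e2 (y1, y2)) y2)
    (hηc : Continuous η) (he1 : Continuous e1) (he2 : Continuous e2)
    (he1K : ∀ y, |e1 y| ≤ K) (he2K : ∀ y, |e2 y| ≤ K)
    (hη0 : ∀ y, 0 ≤ η y) (hηK : ∀ y, η y ≤ K * ρ)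
    (hb1 : ∀ y, η (a1, y) = 0) (hb1' : ∀ y, η (b1, y) = 0)
    (hb2 : ∀ y, η (y, a2) = 0) (hb2' : ∀ y, η (y, b2) = 0)
    (H1 : ∀ᵐ y ∂μ2, ∀ s₁ ∈ Icc a1 b1, ∀ s₂ ∈ Icc a1 b1,
      u (s₂, y) - u (s₁, y) = ∫ s in s₁..s₂, g1 (s, y))
    (H2 : ∀ᵐ x ∂μ1, x ∉ B → ∀ s₁ ∈ Icc a2 b2, ∀ s₂ ∈ Icc a2 b2,
      u (x, s₂) - u (x, s₁) = ∫ s in s₁..s₂, g2 (x, s)) :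
    Real.sqrt ((∫ z, u z * e1 z ∂(μ1.prod μ2)) ^ 2 + (∫ z, u z * e2 z ∂(μ1.prod μ2)) ^ 2)
      ≤ (∫ z, Real.sqrt (g1 z ^ 2 + g2 z ^ 2) * η z ∂(μ1.prod μ2))
        + 2 * K * (volume B).toReal * ∫ z, Real.sqrt (g1 z ^ 2 + g2 z ^ 2) ∂(μ1.prod μ2) := by
  have hab1 : a1 ≤ b1 := by linarith
  have : IsFiniteMeasure μ1 := by rw [hμ1]; infer_instance
  have : IsFiniteMeasure μ2 := by rw [hμ2]; infer_instance
  set G : ℝ × ℝ → ℝ := fun z => Real.sqrt (g1 z ^ 2 + g2 z ^ 2) with hG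
  have hGnn : ∀ z, 0 ≤ G z := fun z => Real.sqrt_nonneg _
  have hG1 : ∀ z, |g1 z| ≤ G z := fun z => Real.abs_le_sqrt (by nlinarith [sq_nonneg (g2 z)])
  have hG2 : ∀ z, |g2 z| ≤ G z := fun z => Real.abs_le_sqrt (by nlinarith [sq_nonneg (g1 z)])
  have hGint : Integrable G (μ1.prod μ2) := by
    refine (hg1.norm.add hg2.norm).mono' ?_ ?_
    · exact Real.continuous_sqrt.comp_aestronglyMeasurable
        ((hg1.aestronglyMeasurable.pow 2).add (hg2.aestronglyMeasurable.pow 2))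
    · refine Eventually.of_forall fun z => ?_
      rw [Real.norm_of_nonneg (hGnn z)]
      simp only [Pi.add_apply, Real.norm_eq_abs, hG]
      rw [Real.sqrt_le_left (by positivity)]
      nlinarith [abs_nonneg (g1 z), abs_nonneg (g2 z), sq_abs (g1 z), sq_abs (g2 z)]
  have hηabs : ∀ y, ‖η y‖ ≤ K * ρ := fun y => by
    rw [Real.norm_of_nonneg (hη0 y)]; exact hηK y
  have hue1 : Integrable (fun z => u z * e1 z) (μ1.prod μ2) :=
    hu.mul_bdd he1.aestronglyMeasurable (Eventually.of_forall he1K)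
  have hue2 : Integrable (fun z => u z * e2 z) (μ1.prod μ2) :=
    hu.mul_bdd he2.aestronglyMeasurable (Eventually.of_forall he2K)
  have hge1 : Integrable (fun z => g1 z * η z) (μ1.prod μ2) :=
    hg1.mul_bdd hηc.aestronglyMeasurable (Eventually.of_forall hηabs)
  have A1 : ∫ z, u z * e1 z ∂(μ1.prod μ2) = - ∫ z, g1 z * η z ∂(μ1.prod μ2) := by
    rw [integral_prod_symm _ hue1, integral_prod_symm _ hge1, ← integral_neg]
    apply integral_congr_ae
    filter_upwards [H1, hg1.prod_left_ae] with y hy hgy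
    rw [hμ1] at hgy ⊢
    exact ibp_aux (v := fun s => u (s, y)) (w := fun s => g1 (s, y)) (η := fun s => η (s, y))
      (e := fun s => e1 (s, y)) hab1 hgy
      (fun s hs => hy a1 (left_mem_Icc.2 hab1) s hs) (fun s => hη1 s y)
      (by fun_prop) (hb1 y) (hb1' y)
  have hvert : ∀ᵐ t ∂μ1, t ∉ B → ∀ y1, ∫ y, u (t, y) * e2 (y1, y) ∂μ2
      = - ∫ y, g2 (t, y) * η (y1, y) ∂μ2 := by
    filter_upwards [H2, hg2.prod_right_ae] with t ht hgt htB y1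
    rw [hμ2] at hgt ⊢
    exact ibp_aux (v := fun s => u (t, s)) (w := fun s => g2 (t, s)) (η := fun s => η (y1, s))
      (e := fun s => e2 (y1, s)) h2.le hgt
      (fun s hs => ht htB a2 (left_mem_Icc.2 h2.le) s hs) (fun s => hη2 y1 s)
      (by fun_prop) (hb2 y1) (hb2' y1)
  set M := 2 * K * ∫ z, G z ∂(μ1.prod μ2) with hM
  have hM0 : 0 ≤ M := by
    have : 0 ≤ ∫ z, G z ∂(μ1.prod μ2) := integral_nonneg fun z => hGnn z
    positivity
  have hF : ∀ᵐ x ∂μ1, ‖∫ y, u (x, y) * e2 (x, y) ∂μ2‖ ≤ M := by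
    have hmem : ∀ᵐ x ∂μ1, x ∈ Ioo a1 b1 := by rw [hμ1]; exact ae_restrict_mem measurableSet_Ioo
    filter_upwards [hu.prod_right_ae, hmem] with x hux hxm
    have hstep : ∀ᵐ t ∂μ1, t ∉ B → ‖∫ y, u (x, y) * e2 (x, y) ∂μ2‖
        ≤ K * ρ * (∫ y, ‖g2 (t, y)‖ ∂μ2) + K * ∫ z, ‖g1 z‖ ∂(μ1.prod μ2) := by
      filter_upwards [hvert, hu.prod_right_ae, hg2.prod_right_ae, hmem] with t ht hut hgt htm htB
      have hcm : AEStronglyMeasurable (fun y => e2 (x, y)) μ2 :=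
        (by fun_prop : Continuous fun y => e2 (x, y)).aestronglyMeasurable
      have i1 : Integrable (fun y => u (t, y) * e2 (x, y)) μ2 :=
        hut.mul_bdd hcm (Eventually.of_forall fun y => he2K _)
      have i2 : Integrable (fun y => (u (x, y) - u (t, y)) * e2 (x, y)) μ2 :=
        (hux.sub hut).mul_bdd hcm (Eventually.of_forall fun y => he2K _)
      have e : ∫ y, u (x, y) * e2 (x, y) ∂μ2 = ∫ y, u (t, y) * e2 (x, y) ∂μ2
          + ∫ y, (u (x, y) - u (t, y)) * e2 (x, y) ∂μ2 := by
        rw [← integral_add i1 i2]; congr 1; ext y; ring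
      rw [e, ht htB x]
      refine (norm_add_le _ _).trans (add_le_add ?_ ?_)
      · rw [norm_neg, ← integral_const_mul]
        refine norm_integral_le_of_norm_le (hgt.norm.const_mul _) (Eventually.of_forall fun y => ?_)
        rw [norm_mul, mul_comm]
        exact mul_le_mul_of_nonneg_right (hηabs _) (norm_nonneg _)
      · rw [integral_prod_symm _ hg1.norm, ← integral_const_mul]
        refine norm_integral_le_of_norm_le (hg1.integral_norm_prod_right.const_mul _) ?_
        filter_upwards [H1, hg1.prod_left_ae] with y hy hgy
        rw [norm_mul, mul_comm]
        refine mul_le_mul (he2K _) ?_ (norm_nonneg _) hK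
        rw [hy t (Ioo_subset_Icc_self htm) x (Ioo_subset_Icc_self hxm)]
        refine intervalIntegral.norm_integral_le_integral_norm_uIoc.trans ?_
        rw [hμ1] at hgy ⊢
        refine setIntegral_mono_set hgy.norm (Eventually.of_forall fun _ => norm_nonneg _) ?_
        refine LE.le.eventuallyLE ?_
        intro s hs
        rcases mem_uIoc.1 hs with hs | hs
        · exact ⟨htm.1.trans hs.1, hs.2.trans_lt hxm.2⟩
        · exact ⟨hxm.1.trans hs.1, hs.2.trans_lt htm.2⟩
    have hsb : ‖∫ y, u (x, y) * e2 (x, y) ∂μ2‖ ≤ K * (∫ z, ‖g2 z‖ ∂(μ1.prod μ2))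
        + K * ∫ z, ‖g1 z‖ ∂(μ1.prod μ2) := by
      subst hμ1
      exact slice_bound hρ h1 hK hBm hB hg2 hstep
    have j1 : ∫ z, ‖g1 z‖ ∂(μ1.prod μ2) ≤ ∫ z, G z ∂(μ1.prod μ2) :=
      integral_mono hg1.norm hGint hG1
    have j2 : ∫ z, ‖g2 z‖ ∂(μ1.prod μ2) ≤ ∫ z, G z ∂(μ1.prod μ2) :=
      integral_mono hg2.norm hGint hG2
    have := mul_le_mul_of_nonneg_left j1 hK
    have := mul_le_mul_of_nonneg_left j2 hK
    rw [hM]; linarith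
  set g2' : ℝ × ℝ → ℝ := (Prod.fst ⁻¹' Bᶜ).indicator g2 with hg2'
  have hSm : MeasurableSet (Prod.fst ⁻¹' Bᶜ : Set (ℝ × ℝ)) := measurable_fst hBm.compl
  have hg2i : Integrable g2' (μ1.prod μ2) := hg2.indicator hSm
  have hge2 : Integrable (fun z => g2' z * η z) (μ1.prod μ2) :=
    hg2i.mul_bdd hηc.aestronglyMeasurable (Eventually.of_forall hηabs)
  have hR : |(∫ z, u z * e2 z ∂(μ1.prod μ2)) + ∫ z, g2' z * η z ∂(μ1.prod μ2)|
      ≤ 2 * K * (volume B).toReal * ∫ z, G z ∂(μ1.prod μ2) := by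
    rw [integral_prod _ hue2, integral_prod _ hge2,
      ← integral_add hue2.integral_prod_left hge2.integral_prod_left]
    have hb : ∀ᵐ x ∂μ1, ‖(∫ y, u (x, y) * e2 (x, y) ∂μ2) + ∫ y, g2' (x, y) * η (x, y) ∂μ2‖
        ≤ B.indicator (fun _ => M) x := by
      filter_upwards [hF, hvert] with x hx hx'
      by_cases hxB : x ∈ B
      · have : ∀ y, g2' (x, y) = 0 := fun y => by simp [hg2', hxB]
        simp only [this, zero_mul, integral_zero, add_zero, indicator_of_mem hxB]
        exact hx
      · have : ∀ y, g2' (x, y) = g2 (x, y) := fun y => by simp [hg2', hxB]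
        simp only [this, indicator_of_notMem hxB]
        rw [hx' hxB x]; simp
    refine (norm_integral_le_of_norm_le ((integrable_const M).indicator hBm) hb).trans ?_
    rw [integral_indicator hBm, setIntegral_const, smul_eq_mul]
    have : μ1.real B ≤ (volume B).toReal := by
      refine ENNReal.toReal_mono (ne_top_of_le_ne_top ENNReal.ofReal_ne_top hB) ?_
      rw [hμ1]; exact Measure.restrict_apply_le _ _
    calc _ ≤ (volume B).toReal * M := mul_le_mul_of_nonneg_right this hM0
      _ = _ := by rw [hM]; ring
  have hGη : Integrable (fun z => G z * η z) (μ1.prod μ2) :=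
    hGint.mul_bdd hηc.aestronglyMeasurable (Eventually.of_forall hηabs)
  have hGη0 : 0 ≤ ∫ z, G z * η z ∂(μ1.prod μ2) :=
    integral_nonneg fun z => mul_nonneg (hGnn z) (hη0 z)
  apply sqrt_le_of_dir
  · exact add_nonneg hGη0 ((abs_nonneg _).trans hR)
  intro a b hab
  have hbabs : |b| ≤ 1 := by
    rw [abs_le_one_iff_mul_self_le_one]; nlinarith [sq_nonneg a]
  set A2 := ∫ z, u z * e2 z ∂(μ1.prod μ2)
  set T2 := ∫ z, g2' z * η z ∂(μ1.prod μ2) with hT2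
  have hcomb : -(a * ∫ z, g1 z * η z ∂(μ1.prod μ2)) - b * T2 ≤ ∫ z, G z * η z ∂(μ1.prod μ2) := by
    have hn : Integrable (fun z => -(a * (g1 z * η z))) (μ1.prod μ2) := (hge1.const_mul a).neg
    rw [hT2, ← integral_const_mul, ← integral_const_mul, ← integral_neg,
      ← integral_sub hn (hge2.const_mul b)]
    refine integral_mono (hn.sub (hge2.const_mul b)) hGη fun z => ?_
    have hz : -(a * g1 z) - b * g2' z ≤ G z := by
      apply Real.le_sqrt_of_sq_le
      have h2' : g2' z ^ 2 ≤ g2 z ^ 2 := by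
        by_cases hz : z ∈ (Prod.fst ⁻¹' Bᶜ : Set (ℝ × ℝ))
        · rw [hg2', indicator_of_mem hz]
        · rw [hg2', indicator_of_notMem hz]; nlinarith [sq_nonneg (g2 z)]
      nlinarith [sq_nonneg (a * g2' z - b * g1 z)]
    have := mul_le_mul_of_nonneg_right hz (hη0 z)
    simp only
    linarith
  have hb2 : b * (A2 + T2) ≤ |A2 + T2| := by
    calc _ ≤ |b * (A2 + T2)| := le_abs_self _
      _ = |b| * |A2 + T2| := abs_mul _ _
      _ ≤ 1 * |A2 + T2| := mul_le_mul_of_nonneg_right hbabs (abs_nonneg _)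
      _ = _ := one_mul _
  rw [A1]
  linarith

lemma mem_sqC {z y : ℝ × ℝ} {s : ℝ} :
    y ∈ sqC z s ↔ (z.1 - s < y.1 ∧ y.1 < z.1 + s) ∧ (z.2 - s < y.2 ∧ y.2 < z.2 + s) := Iff.rfl

lemma isOpen_sqC (z : ℝ × ℝ) (s : ℝ) : IsOpen (sqC z s) := isOpen_Ioo.prod isOpen_Ioo

lemma compact_aux {φ : ℝ × ℝ → ℝ} {s : ℝ} (h : tsupport φ ⊆ sqC (0, 0) s) :
    HasCompactSupport φ :=
  Metric.isCompact_of_isClosed_isBounded (isClosed_tsupport φ)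
    (((Metric.isBounded_Ioo _ _).prod (Metric.isBounded_Ioo _ _)).subset h)

lemma fderiv_conv_aux {r ρ : ℝ} {φ u : ℝ × ℝ → ℝ} (hρ : 0 < ρ)
    (hφ : ContDiff ℝ (⊤ : ℕ∞) φ) (hs : tsupport φ ⊆ sqC (0, 0) (ρ / 2))
    (hu : IntegrableOn u (sqC (0, 0) r) volume) {x : ℝ × ℝ} (hx : x ∈ sqC (0, 0) (r - ρ))
    (v : ℝ × ℝ) :
    fderiv ℝ (conv u φ) x v = ∫ y in sqC x ρ, u y * fderiv ℝ φ (x - y) v := by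
  have hc := compact_aux hs
  have hQm : MeasurableSet (sqC (0, 0) r) := (isOpen_sqC _ _).measurableSet
  set uh := (sqC (0, 0) r).indicator u with huh
  have hui : Integrable uh volume := (integrable_indicator_iff hQm).2 hu
  have hφ1 : ContDiff ℝ 1 φ := hφ.of_le (by exact_mod_cast le_top)
  let L := ContinuousLinearMap.mul ℝ ℝ
  have hD := hc.hasFDerivAt_convolution_right L hui.locallyIntegrable hφ1 x
  have hcongr : conv u φ =ᶠ[𝓝 x] (MeasureTheory.convolution uh φ L volume) := by
    filter_upwards [(isOpen_sqC _ _).mem_nhds hx] with x' hx'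
    rw [conv, MeasureTheory.convolution]
    congr 1; ext y
    simp only [L, ContinuousLinearMap.mul_apply', huh]
    by_cases hy : y ∈ sqC (0, 0) r
    · rw [indicator_of_mem hy]
    · have : φ (x' - y) = 0 := by
        by_contra hne
        apply hy
        have := hs (subset_tsupport _ hne)
        simp only [mem_sqC, Prod.fst_sub, Prod.snd_sub] at this hx' ⊢
        refine ⟨⟨?_, ?_⟩, ?_, ?_⟩ <;> linarith [this.1.1, this.1.2, this.2.1, this.2.2, hx'.1.1, hx'.1.2, hx'.2.1, hx'.2.2]
      rw [this]; simp
  rw [hcongr.fderiv_eq, hD.fderiv, MeasureTheory.convolution]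
  have hex := (hc.fderiv ℝ).convolutionExists_right (L.precompR (ℝ × ℝ)) hui.locallyIntegrable
    (hφ1.continuous_fderiv one_ne_zero) x
  rw [ContinuousLinearMap.integral_apply hex]
  symm
  refine (setIntegral_congr_fun (isOpen_sqC _ _).measurableSet fun y hy => ?_).trans
    (setIntegral_eq_integral_of_forall_compl_eq_zero (s := sqC x ρ) ?_)
  · have hyQ : y ∈ sqC (0, 0) r := by
      simp only [mem_sqC] at hy hx ⊢
      refine ⟨⟨?_, ?_⟩, ?_, ?_⟩ <;> linarith [hy.1.1, hy.1.2, hy.2.1, hy.2.2, hx.1.1, hx.1.2, hx.2.1, hx.2.2]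
    simp [L, huh, indicator_of_mem hyQ, ContinuousLinearMap.precompR_apply]
  · intro y hy
    have : fderiv ℝ φ (x - y) = 0 := by
      by_contra hne
      apply hy
      have := hs (support_fderiv_subset ℝ hne)
      simp only [mem_sqC, Prod.fst_sub, Prod.snd_sub] at this ⊢
      refine ⟨⟨?_, ?_⟩, ?_, ?_⟩ <;> linarith [this.1.1, this.1.2, this.2.1, this.2.2]
    rw [this]; simp

lemma phi_bound_aux {ρ K : ℝ} {φ : ℝ × ℝ → ℝ} (hρ : 0 < ρ) (hK : 0 ≤ K)
    (hφ : ContDiff ℝ (⊤ : ℕ∞) φ) (hs : tsupport φ ⊆ sqC (0, 0) (ρ / 2))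
    (hφK : ∀ x, ‖fderiv ℝ φ x‖ ≤ K) (z : ℝ × ℝ) : φ z ≤ K * ρ := by
  by_cases hz : z ∈ sqC (0, 0) (ρ / 2)
  · have h0 : φ (ρ / 2, z.2) = 0 := by
      by_contra hne
      have := hs (subset_tsupport _ hne)
      simp only [mem_sqC] at this
      linarith [this.1.2]
    have hm := Convex.norm_image_sub_le_of_norm_fderiv_le (𝕜 := ℝ) (f := φ) (C := K) (s := univ)
      (x := (ρ / 2, z.2)) (y := z)
      (fun x _ => (hφ.differentiable (by simp)) x) (fun x _ => hφK x) convex_univ trivial trivial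
    rw [h0, sub_zero] at hm
    have hd : ‖z - (ρ / 2, z.2)‖ ≤ ρ := by
      simp only [mem_sqC] at hz
      rw [Prod.norm_def]
      simp only [Prod.fst_sub, Prod.snd_sub, sub_self, norm_zero, Real.norm_eq_abs]
      apply max_le _ hρ.le
      rw [abs_le]; constructor <;> linarith [hz.1.1, hz.1.2]
    exact (le_abs_self _).trans (hm.trans (mul_le_mul_of_nonneg_left hd hK))
  · have : φ z = 0 := by
      by_contra hne
      exact hz (hs (subset_tsupport _ hne))
    rw [this]; positivity

lemma proj_aux (S : Set (ℝ × ℝ)) : volume (Prod.fst '' S) ≤ μH[1] S := by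
  have := (LipschitzWith.prod_fst (α := ℝ) (β := ℝ)).hausdorffMeasure_image_le zero_le_one S
  rw [hausdorffMeasure_real] at this
  simpa using this

lemma pointwise_aux {r ρ cφ : ℝ} (hcφ : 0 < cφ) (hρ : 0 < ρ)
    {φ : ℝ × ℝ → ℝ} (hφ : ContDiff ℝ (⊤ : ℕ∞) φ) (hs : tsupport φ ⊆ sqC (0, 0) (ρ / 2))
    (hφ0 : ∀ x, 0 ≤ φ x) (hφK : ∀ x, ‖fderiv ℝ φ x‖ ≤ cφ / ρ ^ 3)
    {u : ℝ × ℝ → ℝ} {g : ℝ × ℝ → ℝ × ℝ} {B : Set ℝ} (hBm : MeasurableSet B)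
    (hB : volume B ≤ ENNReal.ofReal ρ)
    (hu : IntegrableOn u (sqC (0, 0) r) volume)
    (hg1 : IntegrableOn (fun z => (g z).1) (sqC (0, 0) r) volume)
    (hg2 : IntegrableOn (fun z => (g z).2) (sqC (0, 0) r) volume)
    (H1 : ∀ᵐ x₂ ∂(volume : Measure ℝ), x₂ ∈ Set.Ioo (-r) r →
          ∀ s₁ ∈ Set.Icc (-r) r, ∀ s₂ ∈ Set.Icc (-r) r,
            u (s₂, x₂) - u (s₁, x₂) = ∫ s in s₁..s₂, (g (s, x₂)).1)
    (H2 : ∀ᵐ x₁ ∂(volume : Measure ℝ), x₁ ∈ Set.Ioo (-r) r → x₁ ∉ B →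
          ∀ s₁ ∈ Set.Icc (-r) r, ∀ s₂ ∈ Set.Icc (-r) r,
            u (x₁, s₂) - u (x₁, s₁) = ∫ s in s₁..s₂, (g (x₁, s)).2)
    {x : ℝ × ℝ} (hx : x ∈ sqC (0, 0) (r - ρ)) :
    ENNReal.ofReal (Real.sqrt ((fderiv ℝ (conv u φ) x (1, 0)) ^ 2
                  + (fderiv ℝ (conv u φ) x (0, 1)) ^ 2))
      ≤ ∫⁻ y, (sqC (0, 0) r).indicator
            (fun y => ENNReal.ofReal (Real.sqrt ((g y).1 ^ 2 + (g y).2 ^ 2))) y *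
          (ENNReal.ofReal (φ (x - y)) + (sqC (0, 0) ρ).indicator
            (fun _ => ENNReal.ofReal (2 * (cφ / ρ ^ 3) * (volume B).toReal)) (x - y)) := by
  have hK : 0 ≤ cφ / ρ ^ 3 := by positivity
  set K := cφ / ρ ^ 3 with hKdef
  have hPm : MeasurableSet (sqC x ρ) := (isOpen_sqC _ _).measurableSet
  have hPQ : sqC x ρ ⊆ sqC (0, 0) r := by
    intro y hy
    simp only [mem_sqC] at hy hx ⊢
    refine ⟨⟨?_, ?_⟩, ?_, ?_⟩ <;> linarith [hy.1.1, hy.1.2, hy.2.1, hy.2.2, hx.1.1, hx.1.2, hx.2.1, hx.2.2]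
  have hx' := hx
  simp only [mem_sqC] at hx'
  obtain ⟨⟨hx1, hx2⟩, hx3, hx4⟩ := hx'
  have hprod : (volume.restrict (Ioo (x.1 - ρ) (x.1 + ρ))).prod
      (volume.restrict (Ioo (x.2 - ρ) (x.2 + ρ))) = volume.restrict (sqC x ρ) := by
    rw [Measure.prod_restrict, ← Measure.volume_eq_prod]; rfl
  have hφd : Differentiable ℝ φ := hφ.differentiable (by simp)
  have hφc : Continuous φ := hφ.continuous
  have hdc : Continuous (fderiv ℝ φ) := hφ.continuous_fderiv (by simp)
  have hz : ∀ z, z ∉ sqC (0, 0) (ρ / 2) → φ z = 0 := by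
    intro z hz
    by_contra hne
    exact hz (hs (subset_tsupport _ hne))
  have hdb : ∀ z v : ℝ × ℝ, ‖v‖ ≤ 1 → |-(fderiv ℝ φ z v)| ≤ K := by
    intro z v hv
    rw [abs_neg]
    exact ((fderiv ℝ φ z).le_opNorm v).trans
      ((mul_le_of_le_one_right (norm_nonneg _) hv).trans (hφK z))
  have hlin1 : ∀ y1 y2 : ℝ, HasDerivAt (fun s : ℝ => x - (s, y2)) (-(1, 0) : ℝ × ℝ) y1 :=
    fun y1 y2 => ((hasDerivAt_id y1).prodMk (hasDerivAt_const y1 y2)).const_sub x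
  have hlin2 : ∀ y1 y2 : ℝ, HasDerivAt (fun s : ℝ => x - (y1, s)) (-(0, 1) : ℝ × ℝ) y2 :=
    fun y1 y2 => ((hasDerivAt_const y2 y1).prodMk (hasDerivAt_id y2)).const_sub x
  have hmain := local_aux (a1 := x.1 - ρ) (b1 := x.1 + ρ) (a2 := x.2 - ρ) (b2 := x.2 + ρ)
    (u := u) (g1 := fun z => (g z).1) (g2 := fun z => (g z).2)
    (η := fun y => φ (x - y)) (e1 := fun y => -(fderiv ℝ φ (x - y) (1, 0)))
    (e2 := fun y => -(fderiv ℝ φ (x - y) (0, 1))) hρ (by ring) (by linarith) hK hBm hB rfl rfl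
    (by rw [hprod]; exact hu.mono_set hPQ) (by rw [hprod]; exact hg1.mono_set hPQ)
    (by rw [hprod]; exact hg2.mono_set hPQ)
    (by
      intro y1 y2
      have := (hφd (x - (y1, y2))).hasFDerivAt.comp_hasDerivAt y1 (hlin1 y1 y2)
      rw [map_neg] at this
      exact this)
    (by
      intro y1 y2
      have := (hφd (x - (y1, y2))).hasFDerivAt.comp_hasDerivAt y2 (hlin2 y1 y2)
      rw [map_neg] at this
      exact this)
    (by fun_prop) (by fun_prop) (by fun_prop)
    (fun y => hdb _ _ (by simp [Prod.norm_def])) (fun y => hdb _ _ (by simp [Prod.norm_def]))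
    (fun y => hφ0 _) (fun y => phi_bound_aux hρ hK hφ hs hφK _)
    (by
      intro y; apply hz
      simp only [mem_sqC, Prod.fst_sub]
      intro h; linarith [h.1.2])
    (by
      intro y; apply hz
      simp only [mem_sqC, Prod.fst_sub]
      intro h; linarith [h.1.1])
    (by
      intro y; apply hz
      simp only [mem_sqC, Prod.snd_sub]
      intro h; linarith [h.2.2])
    (by
      intro y; apply hz
      simp only [mem_sqC, Prod.snd_sub]
      intro h; linarith [h.2.1])
    (by
      filter_upwards [ae_restrict_of_ae H1, ae_restrict_mem measurableSet_Ioo] with y hy hym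
      intro s₁ h₁ s₂ h₂
      refine hy ⟨by linarith [hym.1], by linarith [hym.2]⟩ s₁ ⟨?_, ?_⟩ s₂ ⟨?_, ?_⟩ <;>
        linarith [h₁.1, h₁.2, h₂.1, h₂.2])
    (by
      filter_upwards [ae_restrict_of_ae H2, ae_restrict_mem measurableSet_Ioo] with y hy hym
      intro hyB s₁ h₁ s₂ h₂
      refine hy ⟨by linarith [hym.1], by linarith [hym.2]⟩ hyB s₁ ⟨?_, ?_⟩ s₂ ⟨?_, ?_⟩ <;>
        linarith [h₁.1, h₁.2, h₂.1, h₂.2])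
  rw [hprod] at hmain
  simp only [mul_neg, integral_neg, neg_sq] at hmain
  rw [fderiv_conv_aux hρ hφ hs hu hx, fderiv_conv_aux hρ hφ hs hu hx]
  refine (ENNReal.ofReal_le_ofReal hmain).trans ?_
  set G : ℝ × ℝ → ℝ := fun y => Real.sqrt ((g y).1 ^ 2 + (g y).2 ^ 2) with hG
  have hGnn : ∀ z, 0 ≤ G z := fun z => Real.sqrt_nonneg _
  have hGint : IntegrableOn G (sqC x ρ) volume := by
    refine ((hg1.mono_set hPQ).norm.add (hg2.mono_set hPQ).norm).mono' ?_ ?_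
    · exact Real.continuous_sqrt.comp_aestronglyMeasurable
        (((hg1.mono_set hPQ).aestronglyMeasurable.pow 2).add
          ((hg2.mono_set hPQ).aestronglyMeasurable.pow 2))
    · refine Eventually.of_forall fun z => ?_
      rw [Real.norm_of_nonneg (hGnn z)]
      simp only [Pi.add_apply, Real.norm_eq_abs, hG]
      rw [Real.sqrt_le_left (by positivity)]
      nlinarith [abs_nonneg (g z).1, abs_nonneg (g z).2, sq_abs (g z).1, sq_abs (g z).2]
  have hGφ : IntegrableOn (fun y => G y * φ (x - y)) (sqC x ρ) volume :=
    hGint.mul_bdd (c := K * ρ) (by fun_prop : Continuous fun y => φ (x - y)).aestronglyMeasurable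
      (Eventually.of_forall fun y => by
        rw [Real.norm_of_nonneg (hφ0 _)]; exact phi_bound_aux hρ hK hφ hs hφK _)
  have hC : 0 ≤ 2 * K * (volume B).toReal := by positivity
  have e1 : ENNReal.ofReal (∫ y in sqC x ρ, G y * φ (x - y))
      = ∫⁻ y in sqC x ρ, ENNReal.ofReal (G y) * ENNReal.ofReal (φ (x - y)) := by
    rw [ofReal_integral_eq_lintegral_ofReal hGφ
      (Eventually.of_forall fun y => mul_nonneg (hGnn y) (hφ0 _))]
    congr 1; ext y; exact ENNReal.ofReal_mul (hGnn y)
  have e2 : ENNReal.ofReal (2 * K * (volume B).toReal * ∫ y in sqC x ρ, G y)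
      = ∫⁻ y in sqC x ρ, ENNReal.ofReal (G y) * ENNReal.ofReal (2 * K * (volume B).toReal) := by
    rw [ENNReal.ofReal_mul hC, ofReal_integral_eq_lintegral_ofReal hGint
      (Eventually.of_forall hGnn), lintegral_mul_const' _ _ ENNReal.ofReal_ne_top, mul_comm]
  have hGm : AEMeasurable (fun y => ENNReal.ofReal (G y) * ENNReal.ofReal (φ (x - y)))
      (volume.restrict (sqC x ρ)) :=
    hGint.aestronglyMeasurable.aemeasurable.ennreal_ofReal.mul
      (by fun_prop : Continuous fun y => φ (x - y)).measurable.ennreal_ofReal.aemeasurable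
  refine ENNReal.ofReal_add_le.trans ?_
  rw [e1, e2, ← lintegral_add_left' hGm]
  refine le_trans (le_of_eq ?_) (setLIntegral_le_lintegral (sqC x ρ) _)
  refine setLIntegral_congr_fun hPm fun y hy => ?_
  have hy2 : x - y ∈ sqC (0, 0) ρ := by
    simp only [mem_sqC, Prod.fst_sub, Prod.snd_sub] at hy ⊢
    refine ⟨⟨?_, ?_⟩, ?_, ?_⟩ <;> linarith [hy.1.1, hy.1.2, hy.2.1, hy.2.2]
  simp only [indicator_of_mem (hPQ hy), indicator_of_mem hy2]
  rw [mul_add]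

/-- Mollification with small jump set: there is `c > 0` (depending on `p`
and the chosen mollifier constant `c_φ`) such that for `u ∈ SBV^p(Q_r)` with jumps of
normal `e₂` (encoded via a.e. slice fundamental theorems of calculus with approximate
gradient `g`) and `ℋ¹(J ∩ Q_r) ≤ ρ`, `0 < ρ < r`, one has
`‖∇(u*φ_ρ)‖_{L^p(Q_{r-ρ})} ≤ (1 + c (ℋ¹(J ∩ Q_r)/ρ)^{1/p'}) ‖∇u‖_{L^p(Q_r)}`,
with `p' = p/(p-1)` (so `1/p' = (p-1)/p`); stated with `p`-th powers. -/
theorem stmt6 (p cφ : ℝ) (hp : 1 < p) (hcφ : 0 < cφ) :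
    ∃ c : ℝ, 0 < c ∧
      ∀ (r ρ : ℝ), 0 < ρ → ρ < r →
      ∀ (φ : ℝ × ℝ → ℝ), ContDiff ℝ (⊤ : ℕ∞) φ →
        tsupport φ ⊆ sqC (0, 0) (ρ / 2) →
        (∀ x, 0 ≤ φ x) → (∫ x, φ x) = 1 →
        (∀ x, ‖fderiv ℝ φ x‖ ≤ cφ / ρ ^ 3) →
      ∀ (u : ℝ × ℝ → ℝ) (g : ℝ × ℝ → ℝ × ℝ) (J : Set (ℝ × ℝ)),
        Measurable u → Measurable g →
        IntegrableOn u (sqC (0, 0) r) volume →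
        μH[1] (J ∩ sqC (0, 0) r) ≤ ENNReal.ofReal ρ →
        (∀ᵐ x₂ ∂(volume : Measure ℝ), x₂ ∈ Set.Ioo (-r) r →
          ∀ s₁ ∈ Set.Icc (-r) r, ∀ s₂ ∈ Set.Icc (-r) r,
            u (s₂, x₂) - u (s₁, x₂) = ∫ s in s₁..s₂, (g (s, x₂)).1) →
        (∀ᵐ x₁ ∂(volume : Measure ℝ), x₁ ∈ Set.Ioo (-r) r →
          (∀ s ∈ Set.Ioo (-r) r, (x₁, s) ∉ J) →
          ∀ s₁ ∈ Set.Icc (-r) r, ∀ s₂ ∈ Set.Icc (-r) r,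
            u (x₁, s₂) - u (x₁, s₁) = ∫ s in s₁..s₂, (g (x₁, s)).2) →
        ∫⁻ x in sqC (0, 0) (r - ρ),
            ENNReal.ofReal
              ((Real.sqrt ((fderiv ℝ (conv u φ) x (1, 0)) ^ 2
                  + (fderiv ℝ (conv u φ) x (0, 1)) ^ 2)) ^ p)
          ≤ ENNReal.ofReal
              ((1 + c * (((μH[1] (J ∩ sqC (0, 0) r)).toReal / ρ) ^ ((p - 1) / p))) ^ p) *
            ∫⁻ x in sqC (0, 0) r,
              ENNReal.ofReal ((Real.sqrt ((g x).1 ^ 2 + (g x).2 ^ 2)) ^ p) := by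
  refine ⟨8 * cφ, by positivity, ?_⟩
  intro r ρ hρ hρr φ hφ hs hφ0 hφ1 hφK u g J hum hgm hu hJ H1 H2
  have hp0 : 0 < p := by linarith
  set H := (μH[1] (J ∩ sqC (0, 0) r)).toReal with hH
  have hHρ : H ≤ ρ := ENNReal.toReal_le_of_le_ofReal hρ.le hJ
  have hH0 : 0 ≤ H := ENNReal.toReal_nonneg
  have hQm : MeasurableSet (sqC (0, 0) r) := (isOpen_sqC _ _).measurableSet
  set G : ℝ × ℝ → ℝ := fun y => Real.sqrt ((g y).1 ^ 2 + (g y).2 ^ 2) with hG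
  have hGnn : ∀ z, 0 ≤ G z := fun z => Real.sqrt_nonneg _
  have hGm : Measurable G := by fun_prop
  have hcoef : 1 ≤ (1 + 8 * cφ * ((H / ρ) ^ ((p - 1) / p))) ^ p := by
    apply Real.one_le_rpow _ hp0.le
    have : 0 ≤ 8 * cφ * ((H / ρ) ^ ((p - 1) / p)) := by positivity
    linarith
  by_cases htop : ∫⁻ x in sqC (0, 0) r, ENNReal.ofReal (G x ^ p) = ∞
  · have : ENNReal.ofReal ((1 + 8 * cφ * ((H / ρ) ^ ((p - 1) / p))) ^ p) ≠ 0 := by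
      rw [Ne, ENNReal.ofReal_eq_zero]; linarith
    change _ ≤ _ * ∫⁻ x in sqC (0, 0) r, ENNReal.ofReal (G x ^ p)
    rw [htop, ENNReal.mul_top this]; exact le_top
  have hGp : ∀ z, G z ≤ 1 + G z ^ p := by
    intro z
    rcases le_total (G z) 1 with h | h
    · have := Real.rpow_nonneg (hGnn z) p; linarith
    · have := Real.self_le_rpow_of_one_le h hp.le; linarith
  have hvol : volume (sqC (0, 0) r) = ENNReal.ofReal (2 * r) * ENNReal.ofReal (2 * r) := by
    rw [sqC, Measure.volume_eq_prod, Measure.prod_prod, Real.volume_Ioo]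
    congr 2 <;> ring
  have hGpi : IntegrableOn (fun z => 1 + G z ^ p) (sqC (0, 0) r) volume := by
    refine Integrable.add (integrableOn_const (by rw [hvol]; finiteness)) ?_
    refine ⟨(hGm.pow_const p).aestronglyMeasurable, ?_⟩
    rw [hasFiniteIntegral_iff_ofReal (Eventually.of_forall fun z => Real.rpow_nonneg (hGnn z) p)]
    exact lt_top_iff_ne_top.2 htop
  have hg1 : IntegrableOn (fun z => (g z).1) (sqC (0, 0) r) volume := by
    refine hGpi.mono' hgm.fst.aestronglyMeasurable (Eventually.of_forall fun z => ?_)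
    exact le_trans (Real.abs_le_sqrt (by nlinarith [sq_nonneg (g z).2])) (hGp z)
  have hg2 : IntegrableOn (fun z => (g z).2) (sqC (0, 0) r) volume := by
    refine hGpi.mono' hgm.snd.aestronglyMeasurable (Eventually.of_forall fun z => ?_)
    exact le_trans (Real.abs_le_sqrt (by nlinarith [sq_nonneg (g z).1])) (hGp z)
  set B := toMeasurable volume (Prod.fst '' (J ∩ sqC (0, 0) r)) with hBdef
  have hBm : MeasurableSet B := measurableSet_toMeasurable _ _
  have hBH : volume B ≤ μH[1] (J ∩ sqC (0, 0) r) := by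
    rw [hBdef, measure_toMeasurable]; exact proj_aux _
  have hB : volume B ≤ ENNReal.ofReal ρ := hBH.trans hJ
  have hh : (volume B).toReal ≤ H :=
    ENNReal.toReal_mono (ne_top_of_le_ne_top ENNReal.ofReal_ne_top hJ) hBH
  have H2' : ∀ᵐ x₁ ∂(volume : Measure ℝ), x₁ ∈ Set.Ioo (-r) r → x₁ ∉ B →
          ∀ s₁ ∈ Set.Icc (-r) r, ∀ s₂ ∈ Set.Icc (-r) r,
            u (x₁, s₂) - u (x₁, s₁) = ∫ s in s₁..s₂, (g (x₁, s)).2 := by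
    filter_upwards [H2] with x₁ hx hxr hxB
    refine hx hxr fun s hs hJs => hxB (subset_toMeasurable _ _ ⟨(x₁, s), ⟨hJs, ?_⟩, rfl⟩)
    simp only [mem_sqC, zero_sub, zero_add]
    exact ⟨hxr, hs⟩
  set C := 2 * (cφ / ρ ^ 3) * (volume B).toReal with hC
  have hC0 : 0 ≤ C := by positivity
  set f : ℝ × ℝ → ℝ≥0∞ := (sqC (0, 0) r).indicator (fun y => ENNReal.ofReal (G y)) with hf
  set k : ℝ × ℝ → ℝ≥0∞ := fun z => ENNReal.ofReal (φ z)
    + (sqC (0, 0) ρ).indicator (fun _ => ENNReal.ofReal C) z with hk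
  have hfm : Measurable f := hGm.ennreal_ofReal.indicator hQm
  have hQρ : MeasurableSet (sqC (0, 0) ρ) := (isOpen_sqC _ _).measurableSet
  have hkm : Measurable k := hφ.continuous.measurable.ennreal_ofReal.add
    (measurable_const.indicator hQρ)
  have hvolρ : volume (sqC (0, 0) ρ) = ENNReal.ofReal (2 * ρ * (2 * ρ)) := by
    rw [sqC, Measure.volume_eq_prod, Measure.prod_prod, Real.volume_Ioo,
      ENNReal.ofReal_mul (by positivity)]
    congr 2 <;> ring
  have hkint : ∫⁻ z, k z = ENNReal.ofReal (1 + C * (2 * ρ * (2 * ρ))) := by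
    rw [hk, lintegral_add_left hφ.continuous.measurable.ennreal_ofReal,
      lintegral_indicator_const hQρ, hvolρ, ← ENNReal.ofReal_mul hC0,
      ← ofReal_integral_eq_lintegral_ofReal
        (hφ.continuous.integrable_of_hasCompactSupport (compact_aux hs))
        (Eventually.of_forall hφ0), hφ1, ← ENNReal.ofReal_add zero_le_one (by positivity)]
  have hkle : ∫⁻ z, k z ≤ ENNReal.ofReal (1 + 8 * cφ * ((H / ρ) ^ ((p - 1) / p))) := by
    rw [hkint]
    apply ENNReal.ofReal_le_ofReal
    have e : C * (2 * ρ * (2 * ρ)) = 8 * cφ * ((volume B).toReal / ρ) := by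
      rw [hC]; field_simp; ring
    rw [e]
    have t1 : (volume B).toReal / ρ ≤ H / ρ := by gcongr
    have t2 : H / ρ ≤ (H / ρ) ^ ((p - 1) / p) := by
      have h01 : H / ρ ≤ 1 := by rw [div_le_one hρ]; exact hHρ
      have hex : (p - 1) / p ≤ 1 := by rw [div_le_one hp0]; linarith
      have hex0 : 0 < (p - 1) / p := div_pos (by linarith) hp0
      exact Real.self_le_rpow_of_le_one (by positivity) h01 hex
    have := mul_le_mul_of_nonneg_left (t1.trans t2) (by positivity : 0 ≤ 8 * cφ)
    linarith
  calc _ ≤ ∫⁻ x in sqC (0, 0) (r - ρ), (∫⁻ y, f y * k (x - y)) ^ p := by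
        refine setLIntegral_mono' (isOpen_sqC _ _).measurableSet fun x hx => ?_
        rw [← ENNReal.ofReal_rpow_of_nonneg (Real.sqrt_nonneg _) hp0.le]
        exact ENNReal.rpow_le_rpow
          (pointwise_aux hcφ hρ hφ hs hφ0 hφK hBm hB hu hg1 hg2 H1 H2' hx) hp0.le
    _ ≤ ∫⁻ x, (∫⁻ y, f y * k (x - y)) ^ p := setLIntegral_le_lintegral _ _
    _ ≤ (∫⁻ z, k z) ^ p * ∫⁻ y, f y ^ p := young_aux hp hfm hkm
    _ ≤ _ := by
        refine mul_le_mul' ?_ (le_of_eq ?_)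
        · rw [← ENNReal.ofReal_rpow_of_nonneg (by positivity) hp0.le]
          exact ENNReal.rpow_le_rpow hkle hp0.le
        · rw [← lintegral_indicator hQm]
          congr 1; ext y
          by_cases hy : y ∈ sqC (0, 0) r
          · simp only [hf, indicator_of_mem hy]
            exact ENNReal.ofReal_rpow_of_nonneg (hGnn y) hp0.le
          · simp only [hf, indicator_of_notMem hy]
            exact ENNReal.zero_rpow_of_pos hp0
end

section
/- (Interface length of the recovery sequence) In the setting of the recovery-sequence construction, the second distributional derivative of $u_\theta$ satisfies $\sigma\theta|D^2u_\theta|((0,1)^2)\le2\sigma(1+c\theta)\,\mathcal{H}^1(J_u)+c\sigma\theta$, where $\mathcal{H}^1(J_u)=\sum_{k=0}^K(b_k-a_k)$; in particular $\limsup_{\theta\to0}\sigma\theta|D^2u_\theta|((0,1)^2)\le2\sigma\mathcal{H}^1(J_u)$. -/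
open MeasureTheory Set Filter Finset
open scoped ENNReal Topology BigOperators

/-- Total variation of the second distributional derivative `|D²v|(Ω)` by duality. -/
noncomputable def secondTV (v : ℝ × ℝ → ℝ) (Ω : Set (ℝ × ℝ)) : ℝ≥0∞ :=
  ⨆ Φ : {Φ : (ℝ × ℝ) → (ℝ × ℝ) × (ℝ × ℝ) //
      ContDiff ℝ 1 Φ ∧ (∀ x, ‖Φ x‖ ≤ 1) ∧ tsupport Φ ⊆ Ω},
    ENNReal.ofReal (∫ x in Ω,
      (fderiv ℝ v x (1, 0)) *
          (fderiv ℝ (fun y => ((Φ : (ℝ × ℝ) → (ℝ × ℝ) × (ℝ × ℝ)) y).1.1) x (1, 0) +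
            fderiv ℝ (fun y => ((Φ : (ℝ × ℝ) → (ℝ × ℝ) × (ℝ × ℝ)) y).1.2) x (0, 1)) +
        (fderiv ℝ v x (0, 1)) *
          (fderiv ℝ (fun y => ((Φ : (ℝ × ℝ) → (ℝ × ℝ) × (ℝ × ℝ)) y).2.1) x (1, 0) +
            fderiv ℝ (fun y => ((Φ : (ℝ × ℝ) → (ℝ × ℝ) × (ℝ × ℝ)) y).2.2) x (0, 1)))

/-- The recovery-sequence modification `u_θ` of `u`. -/
noncomputable def recSeq (K : ℕ) (a b y : Fin (K + 1) → ℝ)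
    (h : Fin (K + 1) → ℝ → ℝ) (u : ℝ × ℝ → ℝ) (θ : ℝ) (x : ℝ × ℝ) : ℝ :=
  if hx : ∃ k, x.1 ∈ Set.Ioo (a k) (b k) ∧ x.2 ∈ Set.Ioo (y k) (y k + θ * h k x.1)
  then u x + ((x.2 - y hx.choose) / θ - h hx.choose x.1)
  else u x


lemma bdd_intInt (g : ℝ → ℝ) (hg : Measurable g) (p q M : ℝ) (F : Finset ℝ) (hpq : p ≤ q)
    (hb : ∀ x ∈ Set.Ioo p q, x ∉ F → |g x| ≤ M) : IntervalIntegrable g volume p q := by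
  rw [intervalIntegrable_iff_integrableOn_Ioo_of_le hpq]
  refine Measure.integrableOn_of_bounded (M := M) (by simp) hg.aestronglyMeasurable ?_
  have h1 : ∀ᵐ x ∂(volume.restrict (Set.Ioo p q)), x ∉ (F : Set ℝ) :=
    ae_restrict_of_ae (measure_eq_zero_iff_ae_notMem.1 (F.finite_toSet.measure_zero volume))
  filter_upwards [h1, ae_restrict_mem measurableSet_Ioo] with x h1 h2
  exact hb x h2 (by simpa using h1)

lemma one_d_base (f φ : ℝ → ℝ) (L : ℝ) (hL : 0 ≤ L) (hf : Measurable f)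
    (hφ : ContDiff ℝ 1 φ) (hφ1 : ∀ x, |φ x| ≤ 1) (p q : ℝ) (hpq : p ≤ q) (hlen : q - p ≤ 1)
    (hd : ∀ x ∈ Set.Icc p q, DifferentiableAt ℝ f x ∧ |deriv f x| ≤ L ∧ |f x| ≤ L) :
    |∫ x in p..q, f x * deriv φ x| ≤ 3 * L := by
  have hcd : Continuous (deriv φ) := hφ.continuous_deriv le_rfl
  have huIcc : Set.uIcc p q = Set.Icc p q := Set.uIcc_of_le hpq
  have key := intervalIntegral.integral_mul_deriv_eq_deriv_mul (a := p) (b := q)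
    (u := f) (v := φ) (u' := deriv f) (v' := deriv φ)
    (fun x hx => (hd x (huIcc ▸ hx)).1.hasDerivAt)
    (fun x _ => (hφ.differentiable (by norm_num) x).hasDerivAt)
    (bdd_intInt _ (measurable_deriv f) p q L ∅ hpq
      (fun x hx _ => (hd x (Set.Ioo_subset_Icc_self hx)).2.1))
    (hcd.intervalIntegrable _ _)
  rw [key]
  have h1 : |f q * φ q| ≤ L := by
    first | rw [abs_mul] | rw [Pi.mul_apply, abs_mul]
    have := (hd q ⟨hpq, le_rfl⟩).2.2
    nlinarith [hφ1 q, abs_nonneg (φ q), abs_nonneg (f q)]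
  have h2 : |f p * φ p| ≤ L := by
    first | rw [abs_mul] | rw [Pi.mul_apply, abs_mul]
    have := (hd p ⟨le_rfl, hpq⟩).2.2
    nlinarith [hφ1 p, abs_nonneg (φ p), abs_nonneg (f p)]
  have h3 : |∫ x in p..q, deriv f x * φ x| ≤ L := by
    have := intervalIntegral.norm_integral_le_of_norm_le_const (a := p) (b := q) (C := L)
      (f := fun x => deriv f x * φ x) (by
        intro x hx
        rw [Set.uIoc_of_le hpq] at hx
        have := (hd x ⟨hx.1.le, hx.2⟩).2.1
        rw [Real.norm_eq_abs, abs_mul]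
        nlinarith [hφ1 x, abs_nonneg (φ x), abs_nonneg (deriv f x)])
    rw [Real.norm_eq_abs, abs_of_nonneg (sub_nonneg.2 hpq)] at this
    nlinarith
  rw [abs_le] at *
  constructor <;> linarith [h1.1, h1.2, h2.1, h2.2, h3.1, h3.2]

lemma one_d_open (f φ : ℝ → ℝ) (L : ℝ) (hL : 0 ≤ L) (hf : Measurable f)
    (hφ : ContDiff ℝ 1 φ) (hφ1 : ∀ x, |φ x| ≤ 1) (M : ℝ) (hM : ∀ x, |deriv φ x| ≤ M)
    (p q : ℝ) (hpq : p ≤ q) (hlen : q - p ≤ 1)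
    (hd : ∀ x ∈ Set.Ioo p q, DifferentiableAt ℝ f x ∧ |deriv f x| ≤ L ∧ |f x| ≤ L) :
    |∫ x in p..q, f x * deriv φ x| ≤ 3 * L := by
  rcases hpq.eq_or_lt with rfl | hlt
  · simpa using hL
  have hcd : Continuous (deriv φ) := hφ.continuous_deriv le_rfl
  have hint : IntervalIntegrable (fun x => f x * deriv φ x) volume p q := by
    refine bdd_intInt _ (hf.mul hcd.measurable) p q (L * M) ∅ hpq ?_
    intro x hx _
    first | rw [abs_mul] | rw [Pi.mul_apply, abs_mul]
    exact mul_le_mul (hd x hx).2.2 (hM x) (abs_nonneg _) hL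
  set g : ℝ → ℝ := fun x => f x * deriv φ x with hg
  have hmid : (p + q) / 2 ∈ Set.Ioo p q := ⟨by linarith, by linarith⟩
  set m := (p + q) / 2
  have hcont : ContinuousOn (fun b => ∫ x in m..b, g x) (Set.Icc p q) := by
    have := intervalIntegral.continuousOn_primitive_interval' (μ := volume) (f := g) (a := m)
      (b₁ := p) (b₂ := q) hint (by rw [Set.uIcc_of_le hpq]; exact Set.Ioo_subset_Icc_self hmid)
    rwa [Set.uIcc_of_le hpq] at this
  have hq : Tendsto (fun b => ∫ x in m..b, g x) (𝓝[<] q) (𝓝 (∫ x in m..q, g x)) :=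
    ((hcont q ⟨hpq, le_rfl⟩).mono_left (by
      rw [← nhdsWithin_Ioo_eq_nhdsLT hlt]; exact nhdsWithin_mono _ Set.Ioo_subset_Icc_self))
  have hp : Tendsto (fun b => ∫ x in m..b, g x) (𝓝[>] p) (𝓝 (∫ x in m..p, g x)) :=
    ((hcont p ⟨le_rfl, hpq⟩).mono_left (by
      rw [← nhdsWithin_Ioo_eq_nhdsGT hlt]; exact nhdsWithin_mono _ Set.Ioo_subset_Icc_self))
  have hsub : ∀ r ∈ Set.Icc p q, ∀ s ∈ Set.Icc p q, IntervalIntegrable g volume r s := by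
    intro r hr s hs
    refine hint.mono_set ?_
    rw [Set.uIcc_of_le hpq]
    exact Set.uIcc_subset_Icc hr hs
  have hmI := Set.Ioo_subset_Icc_self hmid
  have step1 : ∀ r ∈ Set.Ioo p m, |(∫ x in m..q, g x) - ∫ x in m..r, g x| ≤ 3 * L := by
    intro r hr
    have hrI : r ∈ Set.Icc p q := ⟨hr.1.le, (hr.2.trans hmid.2).le⟩
    refine le_of_tendsto ((hq.sub_const (∫ x in m..r, g x)).abs) ?_
    filter_upwards [Ioo_mem_nhdsLT hmid.2] with s hs
    have hsI : s ∈ Set.Icc p q := ⟨(hmid.1.trans hs.1).le, hs.2.le⟩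
    rw [intervalIntegral.integral_interval_sub_left (hsub _ hmI _ hsI) (hsub _ hmI _ hrI)]
    refine one_d_base f φ L hL hf hφ hφ1 r s (hr.2.trans hs.1).le (by linarith [hr.1, hs.2]) ?_
    intro x hx
    exact hd x ⟨hr.1.trans_le hx.1, hx.2.trans_lt hs.2⟩
  have step2 : |(∫ x in m..q, g x) - ∫ x in m..p, g x| ≤ 3 * L := by
    refine le_of_tendsto ((hp.const_sub (∫ x in m..q, g x)).abs) ?_
    filter_upwards [Ioo_mem_nhdsGT hmid.1] with s hs using step1 s hs
  rwa [intervalIntegral.integral_interval_sub_left (hsub _ hmI _ ⟨hpq, le_rfl⟩)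
    (hsub _ hmI _ ⟨le_rfl, hpq⟩)] at step2

lemma one_d (f φ : ℝ → ℝ) (L : ℝ) (hL : 0 ≤ L) (hf : Measurable f)
    (hφ : ContDiff ℝ 1 φ) (hφ1 : ∀ x, |φ x| ≤ 1) (M : ℝ) (hM : ∀ x, |deriv φ x| ≤ M) (n : ℕ) :
    ∀ F : Finset ℝ, F.card ≤ n → ∀ p q : ℝ, p ≤ q → q - p ≤ 1 →
    (∀ x ∈ Set.Ioo p q, x ∉ F → DifferentiableAt ℝ f x ∧ |deriv f x| ≤ L ∧ |f x| ≤ L) →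
    |∫ x in p..q, f x * deriv φ x| ≤ 2 ^ n * (3 * L) := by
  have hcd : Continuous (deriv φ) := hφ.continuous_deriv le_rfl
  induction n with
  | zero =>
    intro F hF p q hpq hlen hd
    have : F = ∅ := by simpa using hF
    subst this
    simpa using one_d_open f φ L hL hf hφ hφ1 M hM p q hpq hlen (fun x hx => hd x hx (by simp))
  | succ n ih =>
    intro F hF p q hpq hlen hd
    have hpow : (2:ℝ) ^ (n + 1) * (3 * L) = 2 ^ n * (3 * L) + 2 ^ n * (3 * L) := by ring
    have hnn : 0 ≤ (2:ℝ) ^ n * (3 * L) := by positivity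
    rcases F.eq_empty_or_nonempty with rfl | ⟨s, hs⟩
    · have := ih ∅ (by simp) p q hpq hlen hd
      linarith
    have hcard : (F.erase s).card ≤ n := by
      rw [Finset.card_erase_of_mem hs]; omega
    have hnm : ∀ x, x ≠ s → x ∉ F.erase s → x ∉ F := fun x hx h1 h2 =>
      h1 (Finset.mem_erase.2 ⟨hx, h2⟩)
    by_cases hsI : s ∈ Set.Ioo p q
    · have hint : IntervalIntegrable (fun x => f x * deriv φ x) volume p q := by
        refine bdd_intInt _ (hf.mul hcd.measurable) p q (L * M) F hpq ?_
        intro x hx hxF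
        first | rw [abs_mul] | rw [Pi.mul_apply, abs_mul]
        exact mul_le_mul (hd x hx hxF).2.2 (hM x) (abs_nonneg _) hL
      have h1 := ih (F.erase s) hcard p s hsI.1.le (by linarith [hsI.2])
        (fun x hx hxF => hd x ⟨hx.1, hx.2.trans hsI.2⟩ (hnm x hx.2.ne hxF))
      have h2 := ih (F.erase s) hcard s q hsI.2.le (by linarith [hsI.1])
        (fun x hx hxF => hd x ⟨hsI.1.trans hx.1, hx.2⟩ (hnm x hx.1.ne' hxF))
      rw [← intervalIntegral.integral_add_adjacent_intervals
        (hint.mono_set (Set.uIcc_subset_uIcc_left (by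
          rw [Set.uIcc_of_le hpq]; exact Set.Ioo_subset_Icc_self hsI)))
        (hint.mono_set (Set.uIcc_subset_uIcc_right (by
          rw [Set.uIcc_of_le hpq]; exact Set.Ioo_subset_Icc_self hsI)))]
      exact (abs_add_le _ _).trans (by linarith)
    · have := ih (F.erase s) hcard p q hpq hlen
        (fun x hx hxF => hd x hx (hnm x (fun h => hsI (h ▸ hx)) hxF))
      linarith

lemma sq_integrable (g : ℝ × ℝ → ℝ) (hg : Measurable g) (M : ℝ)
    (hb : ∀ᵐ x ∂(volume.restrict (Set.Ioo (0:ℝ) 1 ×ˢ Set.Ioo (0:ℝ) 1)), |g x| ≤ M) :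
    IntegrableOn g (Set.Ioo (0:ℝ) 1 ×ˢ Set.Ioo (0:ℝ) 1) volume := by
  refine Measure.integrableOn_of_bounded (M := M) ?_ hg.aestronglyMeasurable hb
  rw [Measure.volume_eq_prod, Measure.prod_prod]
  simp

lemma hline_null (c : ℝ) : ∀ᵐ x : ℝ × ℝ, x.2 ≠ c := by
  have : (volume : Measure (ℝ × ℝ)) {x | x.2 = c} = 0 := by
    have h : {x : ℝ × ℝ | x.2 = c} = Set.univ ×ˢ {c} := by ext x; simp
    rw [h, Measure.volume_eq_prod, Measure.prod_prod]; simp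
  exact measure_eq_zero_iff_ae_notMem.1 this

lemma vline_null (c : ℝ) : ∀ᵐ x : ℝ × ℝ, x.1 ≠ c := by
  have : (volume : Measure (ℝ × ℝ)) {x | x.1 = c} = 0 := by
    have h : {x : ℝ × ℝ | x.1 = c} = {c} ×ˢ Set.univ := by ext x; simp
    rw [h, Measure.volume_eq_prod, Measure.prod_prod]; simp
  exact measure_eq_zero_iff_ae_notMem.1 this

lemma finset_hline_null (Y : Finset ℝ) : ∀ᵐ x : ℝ × ℝ, x.2 ∉ Y := by
  have : ∀ c ∈ Y, ∀ᵐ x : ℝ × ℝ, x.2 ≠ c := fun c _ => hline_null c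
  rw [← Finset.eventually_all] at this
  filter_upwards [this] with x hx hxY
  exact hx _ hxY rfl

lemma slice2 (g : ℝ × ℝ → ℝ) (x₁ s : ℝ) (hg : DifferentiableAt ℝ g (x₁, s)) :
    HasDerivAt (fun s => g (x₁, s)) (fderiv ℝ g (x₁, s) (0, 1)) s := by
  have h : HasDerivAt (fun s : ℝ => ((x₁, s) : ℝ × ℝ)) ((0, 1) : ℝ × ℝ) s :=
    (hasDerivAt_const s x₁).prodMk (hasDerivAt_id s)
  exact hg.hasFDerivAt.comp_hasDerivAt s h

lemma slice1 (g : ℝ × ℝ → ℝ) (s x₂ : ℝ) (hg : DifferentiableAt ℝ g (s, x₂)) :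
    HasDerivAt (fun s => g (s, x₂)) (fderiv ℝ g (s, x₂) (1, 0)) s := by
  have h : HasDerivAt (fun s : ℝ => ((s, x₂) : ℝ × ℝ)) ((1, 0) : ℝ × ℝ) s :=
    (hasDerivAt_id s).prodMk (hasDerivAt_const s x₂)
  exact hg.hasFDerivAt.comp_hasDerivAt s h

lemma apply_le (A : ℝ × ℝ →L[ℝ] ℝ) (M : ℝ) (h : ‖A‖ ≤ M) : |A (1, 0)| ≤ M ∧ |A (0, 1)| ≤ M := by
  constructor
  · have := A.le_opNorm (1, 0)
    simp [Prod.norm_def] at this; linarith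
  · have := A.le_opNorm (0, 1)
    simp [Prod.norm_def] at this; linarith

lemma u_part_integrable (g φ : ℝ × ℝ → ℝ) (L M : ℝ) (hL : 0 ≤ L) (Y : Finset ℝ) (hg : Measurable g)
    (hM : ∀ x, ‖fderiv ℝ φ x‖ ≤ M) (e : ℝ × ℝ) (he : e = (1, 0) ∨ e = (0, 1))
    (hd : ∀ x ∈ Set.Ioo (0:ℝ) 1 ×ˢ Set.Ioo (0:ℝ) 1, x.2 ∉ Y → |g x| ≤ L) :
    IntegrableOn (fun x => g x * fderiv ℝ φ x e)
      (Set.Ioo (0:ℝ) 1 ×ˢ Set.Ioo (0:ℝ) 1) volume := by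
  refine sq_integrable _ (hg.mul (measurable_fderiv_apply_const ℝ φ e)) (L * M) ?_
  filter_upwards [ae_restrict_of_ae (finset_hline_null Y),
    ae_restrict_mem (measurableSet_Ioo.prod measurableSet_Ioo)] with x h1 h2
  rw [abs_mul]
  refine mul_le_mul (hd x h2 h1) ?_ (abs_nonneg _) hL
  rcases he with rfl | rfl
  · exact (apply_le _ _ (hM x)).1
  · exact (apply_le _ _ (hM x)).2

lemma u_part2 (g φ : ℝ × ℝ → ℝ) (L M : ℝ) (hL : 0 ≤ L) (n : ℕ) (Y : Finset ℝ) (hY : Y.card ≤ n)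
    (hg : Measurable g) (hφ : ContDiff ℝ 1 φ) (hφ1 : ∀ x, |φ x| ≤ 1)
    (hM : ∀ x, ‖fderiv ℝ φ x‖ ≤ M)
    (hd : ∀ x ∈ Set.Ioo (0:ℝ) 1 ×ˢ Set.Ioo (0:ℝ) 1, x.2 ∉ Y →
      DifferentiableAt ℝ g x ∧ ‖fderiv ℝ g x‖ ≤ L ∧ |g x| ≤ L) :
    |∫ x in Set.Ioo (0:ℝ) 1 ×ˢ Set.Ioo (0:ℝ) 1, g x * fderiv ℝ φ x (0, 1)| ≤ 2 ^ n * (3 * L) := by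
  have hint := u_part_integrable g φ L M hL Y hg hM (0, 1) (Or.inr rfl)
    (fun x hx hy => (hd x hx hy).2.2)
  rw [Measure.volume_eq_prod] at hint ⊢
  rw [setIntegral_prod _ hint]
  have hφd : Differentiable ℝ φ := hφ.differentiable (by norm_num)
  have := norm_setIntegral_le_of_norm_le_const (μ := volume) (s := Set.Ioo (0:ℝ) 1)
    (f := fun x₁ => ∫ x₂ in Set.Ioo (0:ℝ) 1, g (x₁, x₂) * fderiv ℝ φ (x₁, x₂) (0, 1))
    (C := 2 ^ n * (3 * L)) (by simp) (by
      intro x₁ hx₁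
      rw [Real.norm_eq_abs, ← integral_Ioc_eq_integral_Ioo,
        ← intervalIntegral.integral_of_le zero_le_one]
      have hder : ∀ s, deriv (fun s => φ (x₁, s)) s = fderiv ℝ φ (x₁, s) (0, 1) := fun s =>
        (slice2 φ x₁ s (hφd _)).deriv
      have := one_d (fun s => g (x₁, s)) (fun s => φ (x₁, s)) L hL
        (hg.comp measurable_prodMk_left) (hφ.comp (contDiff_const.prodMk contDiff_id))
        (fun x => hφ1 _) M (fun s => by rw [hder]; exact (apply_le _ _ (hM _)).2) n Y hY 0 1
        zero_le_one (by norm_num) (by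
          intro s hs hsY
          obtain ⟨h1, h2, h3⟩ := hd (x₁, s) ⟨hx₁, hs⟩ hsY
          have := slice2 g x₁ s h1
          refine ⟨this.differentiableAt, ?_, h3⟩
          rw [this.deriv]
          exact (apply_le _ _ h2).2)
      simpa only [hder] using this)
  simpa using this

lemma u_part1 (g φ : ℝ × ℝ → ℝ) (L M : ℝ) (hL : 0 ≤ L) (Y : Finset ℝ)
    (hg : Measurable g) (hφ : ContDiff ℝ 1 φ) (hφ1 : ∀ x, |φ x| ≤ 1)
    (hM : ∀ x, ‖fderiv ℝ φ x‖ ≤ M)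
    (hd : ∀ x ∈ Set.Ioo (0:ℝ) 1 ×ˢ Set.Ioo (0:ℝ) 1, x.2 ∉ Y →
      DifferentiableAt ℝ g x ∧ ‖fderiv ℝ g x‖ ≤ L ∧ |g x| ≤ L) :
    |∫ x in Set.Ioo (0:ℝ) 1 ×ˢ Set.Ioo (0:ℝ) 1, g x * fderiv ℝ φ x (1, 0)| ≤ 3 * L := by
  have hint := u_part_integrable g φ L M hL Y hg hM (1, 0) (Or.inl rfl)
    (fun x hx hy => (hd x hx hy).2.2)
  rw [Measure.volume_eq_prod] at hint ⊢
  rw [← setIntegral_prod_swap, setIntegral_prod _ (by exact hint.swap)]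
  have hφd : Differentiable ℝ φ := hφ.differentiable (by norm_num)
  have := norm_setIntegral_le_of_norm_le_const_ae (μ := volume) (s := Set.Ioo (0:ℝ) 1)
    (f := fun x₂ => ∫ x₁ in Set.Ioo (0:ℝ) 1, g (x₁, x₂) * fderiv ℝ φ (x₁, x₂) (1, 0))
    (C := 3 * L) (by simp) (by
      have h1 : ∀ᵐ x : ℝ, x ∉ (Y : Set ℝ) :=
        (measure_eq_zero_iff_ae_notMem.1 (Y.finite_toSet.measure_zero volume))
      filter_upwards [ae_restrict_of_ae h1, ae_restrict_mem measurableSet_Ioo] with x₂ hxY hx₂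
      rw [Real.norm_eq_abs, ← integral_Ioc_eq_integral_Ioo,
        ← intervalIntegral.integral_of_le zero_le_one]
      have hder : ∀ s, deriv (fun s => φ (s, x₂)) s = fderiv ℝ φ (s, x₂) (1, 0) := fun s =>
        (slice1 φ s x₂ (hφd _)).deriv
      have := one_d_open (fun s => g (s, x₂)) (fun s => φ (s, x₂)) L hL
        (hg.comp measurable_prodMk_right) (hφ.comp (contDiff_id.prodMk contDiff_const))
        (fun x => hφ1 _) M (fun s => by rw [hder]; exact (apply_le _ _ (hM _)).1) 0 1
        zero_le_one (by norm_num) (by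
          intro s hs
          obtain ⟨h1, h2, h3⟩ := hd (s, x₂) ⟨hs, hx₂⟩ hxY
          have := slice1 g s x₂ h1
          refine ⟨this.differentiableAt, ?_, h3⟩
          rw [this.deriv]
          exact (apply_le _ _ h2).1)
      simpa only [hder] using this)
  simpa using this

lemma fderiv_zero_off (φ : ℝ × ℝ → ℝ) (Ω : Set (ℝ × ℝ)) (hs : tsupport φ ⊆ Ω) (x : ℝ × ℝ)
    (hx : x ∉ Ω) : fderiv ℝ φ x = 0 := by
  by_contra hne
  exact hx (hs (support_fderiv_subset ℝ hne))

lemma strip_meas (a b y : ℝ) (w : ℝ → ℝ) (hw : Continuous w) :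
    IsOpen {x : ℝ × ℝ | x.1 ∈ Set.Ioo a b ∧ x.2 ∈ Set.Ioo y (y + w x.1)} := by
  have : {x : ℝ × ℝ | x.1 ∈ Set.Ioo a b ∧ x.2 ∈ Set.Ioo y (y + w x.1)} =
      {x : ℝ × ℝ | a < x.1} ∩ {x | x.1 < b} ∩ ({x | y < x.2} ∩ {x | x.2 < y + w x.1}) := by
    ext x; rfl
  rw [this]
  refine ((isOpen_lt ?_ ?_).inter (isOpen_lt ?_ ?_)).inter
    ((isOpen_lt ?_ ?_).inter (isOpen_lt ?_ ?_)) <;> fun_prop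

lemma strip_int (a b y : ℝ) (w F : ℝ → ℝ) (φ : ℝ × ℝ → ℝ) (M M' : ℝ)
    (hw : Continuous w) (hF : Continuous F) (hF' : ∀ t, |F t| ≤ M')
    (hM : ∀ x, ‖fderiv ℝ φ x‖ ≤ M) (e : ℝ × ℝ) (he : e = (1, 0) ∨ e = (0, 1)) :
    IntegrableOn (Set.indicator {x : ℝ × ℝ | x.1 ∈ Set.Ioo a b ∧ x.2 ∈ Set.Ioo y (y + w x.1)}
      (fun x => F x.1 * fderiv ℝ φ x e)) (Set.Ioo (0:ℝ) 1 ×ˢ Set.Ioo (0:ℝ) 1) volume := by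
  refine sq_integrable _ ?_ (M' * M) ?_
  · exact ((hF.measurable.comp measurable_fst).mul
      (measurable_fderiv_apply_const ℝ φ e)).indicator (strip_meas a b y w hw).measurableSet
  · refine Eventually.of_forall fun x => ?_
    have h0 : 0 ≤ M' := (abs_nonneg _).trans (hF' 0)
    have h1 : 0 ≤ M := (norm_nonneg _).trans (hM x)
    have hb : |F x.1 * fderiv ℝ φ x e| ≤ M' * M := by
      rw [abs_mul]
      refine mul_le_mul (hF' _) ?_ (abs_nonneg _) h0
      rcases he with rfl | rfl
      · exact (apply_le _ _ (hM x)).1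
      · exact (apply_le _ _ (hM x)).2
    by_cases hx : x ∈ {x : ℝ × ℝ | x.1 ∈ Set.Ioo a b ∧ x.2 ∈ Set.Ioo y (y + w x.1)}
    · rw [Set.indicator_of_mem hx]; exact hb
    · rw [Set.indicator_of_notMem hx]; simpa using mul_nonneg h0 h1

lemma strip_fubini (a b y : ℝ) (hab : a ≤ b) (w F : ℝ → ℝ) (φ : ℝ × ℝ → ℝ) (M M' : ℝ)
    (hw : Continuous w) (hw0 : ∀ t, 0 ≤ w t) (hF : Continuous F) (hF' : ∀ t, |F t| ≤ M')
    (hM : ∀ x, ‖fderiv ℝ φ x‖ ≤ M) (e : ℝ × ℝ) (he : e = (1, 0) ∨ e = (0, 1))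
    (hs : tsupport φ ⊆ Set.Ioo (0:ℝ) 1 ×ˢ Set.Ioo (0:ℝ) 1) :
    ∫ x in Set.Ioo (0:ℝ) 1 ×ˢ Set.Ioo (0:ℝ) 1,
      Set.indicator {x : ℝ × ℝ | x.1 ∈ Set.Ioo a b ∧ x.2 ∈ Set.Ioo y (y + w x.1)}
        (fun x => F x.1 * fderiv ℝ φ x e) x
    = ∫ t in a..b, F t * ∫ s in y..(y + w t), fderiv ℝ φ (t, s) e := by
  have hint := strip_int a b y w F φ M M' hw hF hF' hM e he
  have hz : ∀ x, x ∉ Set.Ioo (0:ℝ) 1 ×ˢ Set.Ioo (0:ℝ) 1 →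
      Set.indicator {x : ℝ × ℝ | x.1 ∈ Set.Ioo a b ∧ x.2 ∈ Set.Ioo y (y + w x.1)}
        (fun x => F x.1 * fderiv ℝ φ x e) x = 0 := by
    intro x hx
    rw [Set.indicator_apply_eq_zero]
    intro _
    rw [fderiv_zero_off φ _ hs x hx]; simp
  rw [setIntegral_eq_integral_of_forall_compl_eq_zero hz]
  rw [integrableOn_iff_integrable_of_support_subset (by
    intro x hx; by_contra hne; exact hx (hz x hne))] at hint
  rw [Measure.volume_eq_prod] at hint ⊢
  rw [integral_prod _ hint, intervalIntegral.integral_of_le hab, integral_Ioc_eq_integral_Ioo,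
    ← integral_indicator measurableSet_Ioo]
  congr 1
  ext t
  by_cases ht : t ∈ Set.Ioo a b
  · rw [Set.indicator_of_mem ht, intervalIntegral.integral_of_le (by linarith [hw0 t]),
      integral_Ioc_eq_integral_Ioo, ← integral_const_mul, ← integral_indicator measurableSet_Ioo]
    congr 1
    ext s
    by_cases hs : s ∈ Set.Ioo y (y + w t)
    · rw [Set.indicator_of_mem hs, Set.indicator_of_mem (by exact ⟨ht, hs⟩)]
    · rw [Set.indicator_of_notMem hs, Set.indicator_of_notMem (fun h => hs h.2)]
  · rw [Set.indicator_of_notMem ht]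
    have : ∀ s, Set.indicator {x : ℝ × ℝ | x.1 ∈ Set.Ioo a b ∧ x.2 ∈ Set.Ioo y (y + w x.1)}
        (fun x => F x.1 * fderiv ℝ φ x e) (t, s) = 0 := fun s =>
      Set.indicator_of_notMem (fun h => ht h.1) _
    exact (integral_congr_ae (Eventually.of_forall this)).trans (integral_zero _ _)

lemma cont_fderiv_apply (φ : ℝ × ℝ → ℝ) (hφ : ContDiff ℝ 1 φ) (e : ℝ × ℝ) :
    Continuous (fun x => fderiv ℝ φ x e) :=
  (hφ.continuous_fderiv (by norm_num)).clm_apply continuous_const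

lemma strip2 (a b y : ℝ) (hab : a ≤ b) (w F : ℝ → ℝ) (φ : ℝ × ℝ → ℝ) (M M' : ℝ)
    (hw : Continuous w) (hw0 : ∀ t, 0 ≤ w t) (hF : Continuous F) (hF' : ∀ t, |F t| ≤ M')
    (hφ : ContDiff ℝ 1 φ) (hφ1 : ∀ x, |φ x| ≤ 1)
    (hM : ∀ x, ‖fderiv ℝ φ x‖ ≤ M)
    (hs : tsupport φ ⊆ Set.Ioo (0:ℝ) 1 ×ˢ Set.Ioo (0:ℝ) 1) :
    |∫ x in Set.Ioo (0:ℝ) 1 ×ˢ Set.Ioo (0:ℝ) 1,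
      Set.indicator {x : ℝ × ℝ | x.1 ∈ Set.Ioo a b ∧ x.2 ∈ Set.Ioo y (y + w x.1)}
        (fun x => F x.1 * fderiv ℝ φ x (0, 1)) x| ≤ M' * 2 * (b - a) := by
  rw [strip_fubini a b y hab w F φ M M' hw hw0 hF hF' hM _ (Or.inr rfl) hs]
  have := intervalIntegral.norm_integral_le_of_norm_le_const (a := a) (b := b) (C := M' * 2)
      (f := fun t => F t * ∫ s in y..(y + w t), fderiv ℝ φ (t, s) (0, 1)) (by
        intro t _
        rw [intervalIntegral.integral_eq_sub_of_hasDerivAt (f := fun s => φ (t, s))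
          (fun s _ => slice2 φ t s (hφ.differentiable (by norm_num) _))
          (((cont_fderiv_apply φ hφ _).comp (by fun_prop)).intervalIntegrable _ _)]
        rw [Real.norm_eq_abs, abs_mul]
        refine mul_le_mul (hF' t) ?_ (abs_nonneg _) ((abs_nonneg _).trans (hF' 0))
        have h1 := abs_le.1 (hφ1 (t, y + w t))
        have h2 := abs_le.1 (hφ1 (t, y))
        rw [abs_le]; constructor <;> linarith [h1.1, h1.2, h2.1, h2.2])
  rwa [Real.norm_eq_abs, abs_of_nonneg (sub_nonneg.2 hab)] at this

lemma leib (y : ℝ) (w : ℝ → ℝ) (φ : ℝ × ℝ → ℝ) (M W' : ℝ) (hw : ContDiff ℝ 1 w)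
    (hW' : ∀ t, |deriv w t| ≤ W') (hφ : ContDiff ℝ 1 φ) (hM : ∀ x, ‖fderiv ℝ φ x‖ ≤ M) (t : ℝ) :
    HasDerivAt (fun t => ∫ s in y..(y + w t), φ (t, s))
      ((∫ s in y..(y + w t), fderiv ℝ φ (t, s) (1, 0)) + deriv w t * φ (t, y + w t)) t := by
  have hφd : Differentiable ℝ φ := hφ.differentiable (by norm_num)
  have hwd : Differentiable ℝ w := hw.differentiable (by norm_num)
  have hwc : Continuous w := hw.continuous
  have hφc : Continuous φ := hφ.continuous
  have hd1 := cont_fderiv_apply φ hφ (1, 0)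
  have hd2 := cont_fderiv_apply φ hφ (0, 1)
  have cv : ∀ (f : ℝ → ℝ) (t : ℝ), ∫ s in y..(y + w t), f s = w t * ∫ r in (0:ℝ)..1, f (y + w t * r) := by
    intro f t
    have := intervalIntegral.smul_integral_comp_add_mul (a := 0) (b := 1) f (w t) y
    simpa using this.symm
  have hsplit : ∀ (x : ℝ × ℝ) (c : ℝ), fderiv ℝ φ x (1, c) =
      fderiv ℝ φ x (1, 0) + c * fderiv ℝ φ x (0, 1) := by
    intro x c
    have : ((1, c) : ℝ × ℝ) = (1, 0) + c • (0, 1) := by simp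
    rw [this, map_add, map_smul, smul_eq_mul]
  have hpsi : ∀ r t, HasDerivAt (fun t => φ (t, y + w t * r))
      (fderiv ℝ φ (t, y + w t * r) (1, 0) + (deriv w t * r) * fderiv ℝ φ (t, y + w t * r) (0, 1)) t := by
    intro r t
    have h : HasDerivAt (fun t : ℝ => ((t, y + w t * r) : ℝ × ℝ)) ((1, deriv w t * r) : ℝ × ℝ) t :=
      (hasDerivAt_id t).prodMk (((hwd t).hasDerivAt.mul_const r).const_add y)
    have := (hφd _).hasFDerivAt.comp_hasDerivAt t h
    rw [hsplit] at this
    exact this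
  have hH := (intervalIntegral.hasDerivAt_integral_of_dominated_loc_of_deriv_le (𝕜 := ℝ)
    (μ := volume) (a := 0) (b := 1) (s := Set.univ) (x₀ := t)
    (F := fun t r => φ (t, y + w t * r))
    (F' := fun t r => fderiv ℝ φ (t, y + w t * r) (1, 0) +
      (deriv w t * r) * fderiv ℝ φ (t, y + w t * r) (0, 1))
    (bound := fun _ => M + W' * M) univ_mem
    (Eventually.of_forall fun t => (by fun_prop : Continuous _).aestronglyMeasurable)
    ((by fun_prop : Continuous _).intervalIntegrable _ _)
    (Continuous.aestronglyMeasurable (by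
      have h : Continuous (fun r => ((t, y + w t * r) : ℝ × ℝ)) := by fun_prop
      exact (hd1.comp h).add ((continuous_const.mul continuous_id).mul (hd2.comp h))))
    (Eventually.of_forall fun r hr t _ => (by
      rw [Set.uIoc_of_le zero_le_one] at hr
      rw [Real.norm_eq_abs]
      refine (abs_add_le _ _).trans (add_le_add (apply_le _ _ (hM _)).1 ?_)
      rw [abs_mul, abs_mul]
      have hW0 := (abs_nonneg _).trans (hW' 0)
      have : |deriv w t| * |r| ≤ W' := by
        rw [abs_of_pos hr.1]
        nlinarith [hW' t, hr.1, hr.2, abs_nonneg (deriv w t)]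
      exact mul_le_mul this (apply_le _ _ (hM _)).2 (abs_nonneg _) hW0))
    intervalIntegrable_const
    (Eventually.of_forall fun r hr t _ => hpsi r t)).2
  have hG := (hwd t).hasDerivAt.mul hH
  have e1 : (fun t => ∫ s in y..(y + w t), φ (t, s)) =
      (w * fun t => ∫ r in (0:ℝ)..1, φ (t, y + w t * r)) := by
    ext t; exact cv (fun s => φ (t, s)) t
  rw [e1]
  refine hG.congr_deriv ?_
  symm
  have hcurve : Continuous (fun r => ((t, y + w t * r) : ℝ × ℝ)) := by fun_prop
  have i1 : IntervalIntegrable (fun r => fderiv ℝ φ (t, y + w t * r) (1, 0)) volume 0 1 :=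
    (hd1.comp hcurve).intervalIntegrable _ _
  have i2' : Continuous (fun r => fderiv ℝ φ (t, y + w t * r) (0, 1)) := hd2.comp hcurve
  have i0 : Continuous (fun r => φ (t, y + w t * r)) := hφc.comp hcurve
  rw [intervalIntegral.integral_add i1
    ((by fun_prop : Continuous _).intervalIntegrable _ _)]
  rw [cv (fun s => fderiv ℝ φ (t, s) (1, 0)) t]
  have hr : ∀ r, HasDerivAt (fun r => r * φ (t, y + w t * r))
      (φ (t, y + w t * r) + r * (w t * fderiv ℝ φ (t, y + w t * r) (0, 1))) r := by
    intro r
    have h : HasDerivAt (fun r : ℝ => y + w t * r) (w t) r := by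
      simpa using ((hasDerivAt_id r).const_mul (w t)).const_add y
    have h2 := (slice2 φ t (y + w t * r) (hφd _)).comp r h
    have h3 := (hasDerivAt_id r).mul h2
    refine h3.congr_deriv ?_
    simp only [Function.comp, id]; ring
  have hft := intervalIntegral.integral_eq_sub_of_hasDerivAt (a := 0) (b := 1)
    (fun r _ => hr r) ((by fun_prop : Continuous _).intervalIntegrable _ _)
  rw [intervalIntegral.integral_add (i0.intervalIntegrable _ _)
    ((by fun_prop : Continuous _).intervalIntegrable _ _)] at hft
  simp only [one_mul, zero_mul, sub_zero, mul_one] at hft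
  have e2 : ∫ r in (0:ℝ)..1, deriv w t * r * fderiv ℝ φ (t, y + w t * r) (0, 1) =
      deriv w t * ∫ r in (0:ℝ)..1, r * fderiv ℝ φ (t, y + w t * r) (0, 1) := by
    rw [← intervalIntegral.integral_const_mul]; congr 1; ext r; ring
  have e3 : ∫ r in (0:ℝ)..1, r * (w t * fderiv ℝ φ (t, y + w t * r) (0, 1)) =
      w t * ∫ r in (0:ℝ)..1, r * fderiv ℝ φ (t, y + w t * r) (0, 1) := by
    rw [← intervalIntegral.integral_const_mul]; congr 1; ext r; ring
  rw [e3] at hft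
  rw [e2, ← hft]
  ring

lemma strip1 (a b y : ℝ) (hab : a ≤ b) (w F : ℝ → ℝ) (φ : ℝ × ℝ → ℝ) (M M' M'' W W' : ℝ)
    (hw : ContDiff ℝ 1 w) (hw0 : ∀ t, 0 ≤ w t) (hwa : w a = 0) (hwb : w b = 0)
    (hW : ∀ t, w t ≤ W) (hW' : ∀ t, |deriv w t| ≤ W')
    (hF : ContDiff ℝ 1 F) (hF' : ∀ t, |F t| ≤ M') (hF'' : ∀ t, |deriv F t| ≤ M'')
    (hφ : ContDiff ℝ 1 φ) (hφ1 : ∀ x, |φ x| ≤ 1)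
    (hM : ∀ x, ‖fderiv ℝ φ x‖ ≤ M)
    (hs : tsupport φ ⊆ Set.Ioo (0:ℝ) 1 ×ˢ Set.Ioo (0:ℝ) 1) :
    |∫ x in Set.Ioo (0:ℝ) 1 ×ˢ Set.Ioo (0:ℝ) 1,
      Set.indicator {x : ℝ × ℝ | x.1 ∈ Set.Ioo a b ∧ x.2 ∈ Set.Ioo y (y + w x.1)}
        (fun x => F x.1 * fderiv ℝ φ x (1, 0)) x| ≤ (M'' * W + M' * W') * (b - a) := by
  rw [strip_fubini a b y hab w F φ M M' hw.continuous hw0 hF.continuous hF' hM _ (Or.inl rfl) hs]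
  have hwc : Continuous w := hw.continuous
  have hFc : Continuous F := hF.continuous
  have hφc : Continuous φ := hφ.continuous
  have hw'c : Continuous (deriv w) := hw.continuous_deriv le_rfl
  have hF'c : Continuous (deriv F) := hF.continuous_deriv le_rfl
  set G : ℝ → ℝ := fun t => ∫ s in y..(y + w t), φ (t, s) with hGdef
  have hG : ∀ t, HasDerivAt G _ t := fun t => leib y w φ M W' hw hW' hφ hM t
  have hM0 : 0 ≤ M := (norm_nonneg _).trans (hM 0)
  have hM'0 : 0 ≤ M' := (abs_nonneg _).trans (hF' 0)
  have hM''0 : 0 ≤ M'' := (abs_nonneg _).trans (hF'' 0)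
  have hGc : Continuous G := continuous_iff_continuousAt.2 fun t => (hG t).continuousAt
  have hinner : ∀ t, ∫ s in y..(y + w t), fderiv ℝ φ (t, s) (1, 0) =
      deriv G t - deriv w t * φ (t, y + w t) := by
    intro t; rw [(hG t).deriv]; ring
  have hGb : ∀ t, |G t| ≤ W := by
    intro t
    have := intervalIntegral.norm_integral_le_of_norm_le_const (a := y) (b := y + w t) (C := 1)
      (f := fun s => φ (t, s)) (fun s _ => hφ1 _)
    rw [Real.norm_eq_abs, add_sub_cancel_left, abs_of_nonneg (hw0 t), one_mul] at this
    exact this.trans (hW t)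
  have hG'b : ∀ t, |deriv G t| ≤ M * W + W' := by
    intro t
    rw [(hG t).deriv]
    refine (abs_add_le _ _).trans (add_le_add ?_ ?_)
    · have := intervalIntegral.norm_integral_le_of_norm_le_const (a := y) (b := y + w t) (C := M)
        (f := fun s => fderiv ℝ φ (t, s) (1, 0)) (fun s _ => (apply_le _ _ (hM _)).1)
      rw [Real.norm_eq_abs, add_sub_cancel_left, abs_of_nonneg (hw0 t)] at this
      exact this.trans (mul_le_mul_of_nonneg_left (hW t) hM0)
    · rw [abs_mul]
      nlinarith [hW' t, hφ1 (t, y + w t), abs_nonneg (deriv w t), abs_nonneg (φ (t, y + w t))]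
  have hG'int : IntervalIntegrable (deriv G) volume a b :=
    bdd_intInt _ (measurable_deriv G) a b (M * W + W') ∅ hab (fun t _ _ => hG'b t)
  have ibp := intervalIntegral.integral_mul_deriv_eq_deriv_mul (a := a) (b := b)
    (u := F) (v := G) (u' := deriv F) (v' := deriv G)
    (fun x _ => (hF.differentiable (by norm_num) x).hasDerivAt)
    (fun x _ => (hG x).differentiableAt.hasDerivAt)
    (hF'c.intervalIntegrable _ _) hG'int
  have hGa : G a = 0 := by simp [hGdef, hwa]
  have hGb' : G b = 0 := by simp [hGdef, hwb]
  rw [hGa, hGb'] at ibp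
  have hrw : ∫ t in a..b, F t * ∫ s in y..(y + w t), fderiv ℝ φ (t, s) (1, 0) =
      (∫ t in a..b, F t * deriv G t) - ∫ t in a..b, F t * (deriv w t * φ (t, y + w t)) := by
    rw [← intervalIntegral.integral_sub]
    · congr 1; ext t; rw [hinner]; ring
    · exact hG'int.continuousOn_mul hFc.continuousOn
    · exact (by fun_prop : Continuous _).intervalIntegrable _ _
  rw [hrw, ibp]
  have b1 := intervalIntegral.norm_integral_le_of_norm_le_const (a := a) (b := b) (C := M'' * W)
    (f := fun t => deriv F t * G t) (fun t _ => by
      rw [Real.norm_eq_abs, abs_mul]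
      exact mul_le_mul (hF'' t) (hGb t) (abs_nonneg _) hM''0)
  have b2 := intervalIntegral.norm_integral_le_of_norm_le_const (a := a) (b := b) (C := M' * W')
    (f := fun t => F t * (deriv w t * φ (t, y + w t))) (fun t _ => by
      rw [Real.norm_eq_abs, abs_mul]
      refine mul_le_mul (hF' t) ?_ (abs_nonneg _) hM'0
      rw [abs_mul]
      nlinarith [hW' t, hφ1 (t, y + w t), abs_nonneg (deriv w t), abs_nonneg (φ (t, y + w t))])
  rw [Real.norm_eq_abs, abs_of_nonneg (sub_nonneg.2 hab), abs_le] at b1 b2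
  rw [abs_le]
  constructor <;> linarith [b1.1, b1.2, b2.1, b2.2]

lemma tip (u : ℝ × ℝ → ℝ) (a b y c r L H x₁ x₁' : ℝ) (hr : 0 < r)
    (hbox : ∀ x : ℝ × ℝ, |x.1 - c| < r → |x.2 - y| < r → ¬ (x.1 ∈ Set.Icc a b ∧ x.2 = y) →
      DifferentiableAt ℝ u x ∧ ‖fderiv ℝ u x‖ ≤ L)
    (h1 : |x₁ - c| < r) (h1' : |x₁' - c| < r) (hx1' : x₁' ∉ Set.Icc a b)
    (hj : Tendsto (fun t : ℝ => u (x₁, y + t) - u (x₁, y - t)) (𝓝[>] 0) (𝓝 H)) :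
    |H| ≤ 2 * L * |x₁ - x₁'| := by
  have hbd : ∀ t ∈ Set.Ioo 0 r, |u (x₁, y + t) - u (x₁, y - t)| ≤ 2 * L * |x₁ - x₁'| + 2 * L * t := by
    intro t ht
    rw [abs_lt] at h1 h1'
    have hA : ∀ s : ℝ, s ≠ 0 → |s| < r → |u (x₁, y + s) - u (x₁', y + s)| ≤ L * |x₁ - x₁'| := by
      intro s hs hsr
      have hconv : Convex ℝ (Set.Ioo (c - r) (c + r) ×ˢ ({y + s} : Set ℝ)) :=
        (convex_Ioo _ _).prod (convex_singleton _)
      have hP : ∀ x ∈ Set.Ioo (c - r) (c + r) ×ˢ ({y + s} : Set ℝ),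
          DifferentiableAt ℝ u x ∧ ‖fderiv ℝ u x‖ ≤ L := by
        rintro ⟨p, q⟩ ⟨hp, hq⟩
        simp only [Set.mem_singleton_iff] at hq
        subst hq
        refine hbox _ (abs_lt.2 ⟨by linarith [hp.1], by linarith [hp.2]⟩) (by simpa using hsr) ?_
        rintro ⟨_, h⟩
        simp at h
        exact hs h
      have := hconv.norm_image_sub_le_of_norm_fderiv_le (f := u) (𝕜 := ℝ) (fun x hx => (hP x hx).1)
        (fun x hx => (hP x hx).2) (x := (x₁', y + s)) (y := (x₁, y + s))
        ⟨⟨by simp; linarith [h1'.1], by simp; linarith [h1'.2]⟩, rfl⟩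
        ⟨⟨by simp; linarith [h1.1], by simp; linarith [h1.2]⟩, rfl⟩
      simpa [Prod.norm_def] using this
    have hB : |u (x₁', y + t) - u (x₁', y - t)| ≤ L * (2 * t) := by
      have hconv : Convex ℝ (({x₁'} : Set ℝ) ×ˢ Set.Ioo (y - r) (y + r)) :=
        (convex_singleton _).prod (convex_Ioo _ _)
      have hP : ∀ x ∈ ({x₁'} : Set ℝ) ×ˢ Set.Ioo (y - r) (y + r),
          DifferentiableAt ℝ u x ∧ ‖fderiv ℝ u x‖ ≤ L := by
        rintro ⟨p, q⟩ ⟨hp, hq⟩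
        simp only [Set.mem_singleton_iff] at hp
        subst hp
        refine hbox _ (abs_lt.2 h1') (abs_lt.2 ⟨by linarith [hq.1], by linarith [hq.2]⟩) ?_
        rintro ⟨h, _⟩
        exact hx1' h
      have := hconv.norm_image_sub_le_of_norm_fderiv_le (f := u) (𝕜 := ℝ) (fun x hx => (hP x hx).1)
        (fun x hx => (hP x hx).2) (x := (x₁', y - t)) (y := (x₁', y + t))
        ⟨rfl, ⟨by simp; linarith [ht.2], by simp; linarith [ht.1, ht.2]⟩⟩
        ⟨rfl, ⟨by simp; linarith [ht.1, ht.2], by simp; linarith [ht.2]⟩⟩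
      have e : ‖((x₁', y + t) : ℝ × ℝ) - (x₁', y - t)‖ = 2 * t := by
        have : ((x₁', y + t) : ℝ × ℝ) - (x₁', y - t) = (0, 2 * t) := by
          ext <;> simp; ring
        rw [this, Prod.norm_def]
        simp [abs_of_pos ht.1, ht.1.le]
      rw [e] at this
      exact this
    have a1 := hA t ht.1.ne' (by rw [abs_of_pos ht.1]; exact ht.2)
    have a2 := hA (-t) (by linarith [ht.1]) (by rw [abs_neg, abs_of_pos ht.1]; exact ht.2)
    rw [← sub_eq_add_neg] at a2
    rw [abs_le] at a1 a2 hB ⊢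
    constructor <;> linarith [a1.1, a1.2, a2.1, a2.2, hB.1, hB.2]
  have hlim : Tendsto (fun t : ℝ => 2 * L * |x₁ - x₁'| + 2 * L * t) (𝓝[>] 0)
      (𝓝 (2 * L * |x₁ - x₁'|)) := by
    have : Continuous (fun t : ℝ => 2 * L * |x₁ - x₁'| + 2 * L * t) := by fun_prop
    have := (this.tendsto 0).mono_left (nhdsWithin_le_nhds (s := Set.Ioi 0))
    simpa using this
  refine le_of_tendsto_of_tendsto hj.abs hlim ?_
  filter_upwards [Ioo_mem_nhdsGT hr] with t ht using hbd t ht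

lemma tip_zero (u : ℝ × ℝ → ℝ) (h : ℝ → ℝ) (hh : Continuous h) (a b y c r L e : ℝ) (hr : 0 < r)
    (hab : a < b) (hc : (c = a ∧ e = 1) ∨ (c = b ∧ e = -1))
    (hbox : ∀ x : ℝ × ℝ, |x.1 - c| < r → |x.2 - y| < r → ¬ (x.1 ∈ Set.Icc a b ∧ x.2 = y) →
      DifferentiableAt ℝ u x ∧ ‖fderiv ℝ u x‖ ≤ L)
    (hj : ∀ x₁ ∈ Set.Ioo a b,
      Tendsto (fun t : ℝ => u (x₁, y + t) - u (x₁, y - t)) (𝓝[>] 0) (𝓝 (h x₁))) : h c = 0 := by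
  have hl1 : Tendsto (fun s : ℝ => |h (c + e * s)|) (𝓝[>] 0) (𝓝 |h c|) := by
    have : Continuous (fun s : ℝ => |h (c + e * s)|) := by fun_prop
    have := (this.tendsto 0).mono_left (nhdsWithin_le_nhds (s := Set.Ioi 0))
    simpa using this
  have hl2 : Tendsto (fun s : ℝ => 2 * L * (2 * s)) (𝓝[>] 0) (𝓝 0) := by
    have : Continuous (fun s : ℝ => 2 * L * (2 * s)) := by fun_prop
    have := (this.tendsto 0).mono_left (nhdsWithin_le_nhds (s := Set.Ioi 0))
    simpa using this
  have : |h c| ≤ 0 := by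
    refine le_of_tendsto_of_tendsto hl1 hl2 ?_
    filter_upwards [Ioo_mem_nhdsGT (lt_min hr (sub_pos.2 hab))] with s hs
    have hs1 := hs.2.trans_le (min_le_left _ _)
    have hs2 := hs.2.trans_le (min_le_right _ _)
    have hs0 := hs.1
    have he : |e| = 1 := by rcases hc with ⟨_, rfl⟩ | ⟨_, rfl⟩ <;> simp
    have := tip u a b y c r L (h (c + e * s)) (c + e * s) (c - e * s) hr hbox
      (by rw [add_sub_cancel_left, abs_mul, he, abs_of_pos hs0]; linarith)
      (by rw [sub_sub_cancel_left, abs_neg, abs_mul, he, abs_of_pos hs0]; linarith)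
      (by
        rcases hc with ⟨rfl, rfl⟩ | ⟨rfl, rfl⟩
        · intro h; linarith [h.1]
        · intro h; linarith [h.2])
      (hj _ (by
        rcases hc with ⟨rfl, rfl⟩ | ⟨rfl, rfl⟩
        · constructor <;> linarith
        · constructor <;> linarith))
    have e2 : |c + e * s - (c - e * s)| = 2 * s := by
      rw [show c + e * s - (c - e * s) = e * (2 * s) by ring, abs_mul, he, one_mul,
        abs_of_pos (by linarith)]
    rwa [e2] at this
  exact abs_nonpos_iff.1 this

lemma graph_null (g : ℝ → ℝ) (hg : Continuous g) : ∀ᵐ x : ℝ × ℝ, x.2 ≠ g x.1 := by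
  have hm : MeasurableSet {x : ℝ × ℝ | x.2 = g x.1} :=
    (isClosed_eq (by fun_prop) (by fun_prop)).measurableSet
  have : (volume : Measure (ℝ × ℝ)) {x | x.2 = g x.1} = 0 := by
    rw [Measure.volume_eq_prod, Measure.measure_prod_null hm]
    refine Eventually.of_forall fun t => ?_
    have : Prod.mk t ⁻¹' {x : ℝ × ℝ | x.2 = g x.1} = {g t} := by ext s; simp
    simp only [this]; simp
  exact measure_eq_zero_iff_ae_notMem.1 this

lemma block (K : ℕ) (a b y : Fin (K + 1) → ℝ) (w F : Fin (K + 1) → ℝ → ℝ)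
    (g φ : ℝ × ℝ → ℝ) (L M M' B : ℝ) (hL : 0 ≤ L) (Y : Finset ℝ) (e : ℝ × ℝ)
    (he : e = (1, 0) ∨ e = (0, 1)) (Bk : Fin (K + 1) → ℝ)
    (hg : Measurable g) (hM : ∀ x, ‖fderiv ℝ φ x‖ ≤ M)
    (hd : ∀ x ∈ Set.Ioo (0:ℝ) 1 ×ˢ Set.Ioo (0:ℝ) 1, x.2 ∉ Y → |g x| ≤ L)
    (hw : ∀ k, Continuous (w k)) (hF : ∀ k, Continuous (F k)) (hF' : ∀ k t, |F k t| ≤ M')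
    (hB : |∫ x in Set.Ioo (0:ℝ) 1 ×ˢ Set.Ioo (0:ℝ) 1, g x * fderiv ℝ φ x e| ≤ B)
    (hBk : ∀ k, |∫ x in Set.Ioo (0:ℝ) 1 ×ˢ Set.Ioo (0:ℝ) 1,
      Set.indicator {x : ℝ × ℝ | x.1 ∈ Set.Ioo (a k) (b k) ∧ x.2 ∈ Set.Ioo (y k) (y k + w k x.1)}
        (fun x => F k x.1 * fderiv ℝ φ x e) x| ≤ Bk k) :
    IntegrableOn (fun x => (g x + ∑ k, Set.indicator {x : ℝ × ℝ | x.1 ∈ Set.Ioo (a k) (b k) ∧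
      x.2 ∈ Set.Ioo (y k) (y k + w k x.1)} (fun x => F k x.1) x) * fderiv ℝ φ x e)
      (Set.Ioo (0:ℝ) 1 ×ˢ Set.Ioo (0:ℝ) 1) volume ∧
    ∫ x in Set.Ioo (0:ℝ) 1 ×ˢ Set.Ioo (0:ℝ) 1, (g x + ∑ k, Set.indicator {x : ℝ × ℝ |
      x.1 ∈ Set.Ioo (a k) (b k) ∧
      x.2 ∈ Set.Ioo (y k) (y k + w k x.1)} (fun x => F k x.1) x) * fderiv ℝ φ x e
      ≤ B + ∑ k, Bk k := by
  have e1 : (fun x => (g x + ∑ k, Set.indicator {x : ℝ × ℝ | x.1 ∈ Set.Ioo (a k) (b k) ∧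
      x.2 ∈ Set.Ioo (y k) (y k + w k x.1)} (fun x => F k x.1) x) * fderiv ℝ φ x e) =
      fun x => g x * fderiv ℝ φ x e + ∑ k, Set.indicator {x : ℝ × ℝ | x.1 ∈ Set.Ioo (a k) (b k) ∧
      x.2 ∈ Set.Ioo (y k) (y k + w k x.1)} (fun x => F k x.1 * fderiv ℝ φ x e) x := by
    ext x
    rw [add_mul, Finset.sum_mul]
    congr 1
    refine Finset.sum_congr rfl fun k _ => ?_
    rw [Set.indicator_apply, Set.indicator_apply]
    split_ifs <;> simp
  rw [e1]
  have i1 := u_part_integrable g φ L M hL Y hg hM e he hd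
  have i2 := fun k => strip_int (a k) (b k) (y k) (w k) (F k) φ M M' (hw k) (hF k) (hF' k) hM e he
  have i3 := integrable_finsetSum Finset.univ (fun k _ => (i2 k).integrable)
  refine ⟨i1.integrable.add i3, ?_⟩
  rw [integral_add i1.integrable i3, integral_finsetSum _ (fun k _ => (i2 k).integrable)]
  exact add_le_add ((le_abs_self _).trans hB)
    (Finset.sum_le_sum fun k _ => (le_abs_self _).trans (hBk k))
lemma seg_uniq (K : ℕ) (a b y : Fin (K + 1) → ℝ) (ρ L : ℝ) (h : Fin (K + 1) → ℝ → ℝ)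
    (hsep : ∀ k l, k ≠ l → ∀ x₁ ∈ Set.Icc (a k) (b k), ∀ x₁' ∈ Set.Icc (a l) (b l),
      2 * ρ < dist ((x₁, y k) : ℝ × ℝ) ((x₁', y l) : ℝ × ℝ))
    (hρ : 0 < ρ) (hhL : ∀ k t, h k t ≤ L) (θ : ℝ) (hθ : 0 < θ) (hθL : θ * L ≤ ρ)
    (x : ℝ × ℝ) (k l : Fin (K + 1))
    (hk : x.1 ∈ Set.Ioo (a k) (b k) ∧ x.2 ∈ Set.Ioo (y k) (y k + θ * h k x.1))
    (hl : x.1 ∈ Set.Ioo (a l) (b l) ∧ x.2 ∈ Set.Ioo (y l) (y l + θ * h l x.1)) : k = l := by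
  by_contra hne
  have := hsep k l hne x.1 (Set.Ioo_subset_Icc_self hk.1) x.1 (Set.Ioo_subset_Icc_self hl.1)
  rw [Prod.dist_eq] at this
  simp only [dist_self] at this
  rw [max_eq_right dist_nonneg, Real.dist_eq] at this
  have h1 := mul_le_mul_of_nonneg_left (hhL k x.1) hθ.le
  have h2 := mul_le_mul_of_nonneg_left (hhL l x.1) hθ.le
  have h3 : |y k - y l| ≤ 2 * ρ := by
    rw [abs_le]
    constructor <;> linarith [hk.2.1, hk.2.2, hl.2.1, hl.2.2]
  linarith

lemma rec_grad (K : ℕ) (a b y : Fin (K + 1) → ℝ) (h : Fin (K + 1) → ℝ → ℝ) (u : ℝ × ℝ → ℝ)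
    (θ : ℝ) (hsmooth : ∀ k, ContDiff ℝ 1 (h k))
    (huniq : ∀ (x : ℝ × ℝ) (k l : Fin (K + 1)),
      (x.1 ∈ Set.Ioo (a k) (b k) ∧ x.2 ∈ Set.Ioo (y k) (y k + θ * h k x.1)) →
      (x.1 ∈ Set.Ioo (a l) (b l) ∧ x.2 ∈ Set.Ioo (y l) (y l + θ * h l x.1)) → k = l)
    (x : ℝ × ℝ) (hu : DifferentiableAt ℝ u x)
    (h1 : ∀ k, x.1 ≠ a k) (h2 : ∀ k, x.1 ≠ b k) (h3 : ∀ k, x.2 ≠ y k)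
    (h4 : ∀ k, x.2 ≠ y k + θ * h k x.1) :
    fderiv ℝ (recSeq K a b y h u θ) x (1, 0) = fderiv ℝ u x (1, 0) +
      ∑ k, Set.indicator {x : ℝ × ℝ | x.1 ∈ Set.Ioo (a k) (b k) ∧
        x.2 ∈ Set.Ioo (y k) (y k + θ * h k x.1)} (fun x => - deriv (h k) x.1) x ∧
    fderiv ℝ (recSeq K a b y h u θ) x (0, 1) = fderiv ℝ u x (0, 1) +
      ∑ k, Set.indicator {x : ℝ × ℝ | x.1 ∈ Set.Ioo (a k) (b k) ∧
        x.2 ∈ Set.Ioo (y k) (y k + θ * h k x.1)} (fun _ => 1 / θ) x := by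
  have hc : ∀ k, Continuous (fun t => θ * h k t) := fun k =>
    continuous_const.mul (hsmooth k).continuous
  have hcx : ∀ k, Continuous (fun z : ℝ × ℝ => y k + θ * h k z.1) := fun k =>
    continuous_const.add ((hc k).comp continuous_fst)
  by_cases hx : ∃ k, x.1 ∈ Set.Ioo (a k) (b k) ∧ x.2 ∈ Set.Ioo (y k) (y k + θ * h k x.1)
  · obtain ⟨k, hk⟩ := hx
    have hev : recSeq K a b y h u θ =ᶠ[𝓝 x] fun z => u z + ((z.2 - y k) / θ - h k z.1) := by
      filter_upwards [(strip_meas (a k) (b k) (y k) (fun t => θ * h k t) (hc k)).mem_nhds hk]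
        with z hz
      have hz' : ∃ k, z.1 ∈ Set.Ioo (a k) (b k) ∧ z.2 ∈ Set.Ioo (y k) (y k + θ * h k z.1) :=
        ⟨k, hz⟩
      have hck : hz'.choose = k := huniq z _ _ hz'.choose_spec hz
      rw [recSeq, dif_pos hz', hck]
    have hder : HasFDerivAt (fun z : ℝ × ℝ => u z + ((z.2 - y k) / θ - h k z.1))
        (fderiv ℝ u x + ((1 / θ) • ContinuousLinearMap.snd ℝ ℝ ℝ -
          (deriv (h k) x.1) • ContinuousLinearMap.fst ℝ ℝ ℝ)) x := by
      refine hu.hasFDerivAt.add (HasFDerivAt.sub ?_ ?_)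
      · have : (fun z : ℝ × ℝ => (z.2 - y k) / θ) = fun z => (1 / θ) * (z.2 - y k) := by
          ext z; ring
        rw [this]
        exact (hasFDerivAt_snd.sub_const (y k)).const_mul (1 / θ)
      · exact ((hsmooth k).differentiable (by norm_num) x.1).hasDerivAt.comp_hasFDerivAt x
          hasFDerivAt_fst
    rw [hev.fderiv_eq, hder.fderiv]
    have hs : ∀ f : Fin (K + 1) → ℝ × ℝ → ℝ,
        ∑ k, Set.indicator {x : ℝ × ℝ | x.1 ∈ Set.Ioo (a k) (b k) ∧
        x.2 ∈ Set.Ioo (y k) (y k + θ * h k x.1)} (f k) x = f k x := by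
      intro f
      rw [Finset.sum_eq_single k]
      · exact Set.indicator_of_mem (by exact hk) _
      · intro l _ hl
        rw [Set.indicator_of_notMem]
        exact fun hm => hl (huniq x l k hm hk)
      · simp
    rw [hs (fun k x => - deriv (h k) x.1), hs (fun _ _ => 1 / θ)]
    constructor <;> simp
  · have hev : recSeq K a b y h u θ =ᶠ[𝓝 x] u := by
      have hall : ∀ k, ∀ᶠ z : ℝ × ℝ in 𝓝 x,
          ¬ (z.1 ∈ Set.Ioo (a k) (b k) ∧ z.2 ∈ Set.Ioo (y k) (y k + θ * h k z.1)) := by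
        intro k
        have hk : ¬ (x.1 ∈ Set.Ioo (a k) (b k) ∧ x.2 ∈ Set.Ioo (y k) (y k + θ * h k x.1)) :=
          fun hk => hx ⟨k, hk⟩
        rcases lt_or_gt_of_ne (h1 k) with hh | ha
        · filter_upwards [(isOpen_lt continuous_fst continuous_const).mem_nhds hh] with z hz hm
          exact lt_asymm hz hm.1.1
        rcases lt_or_gt_of_ne (h2 k).symm with hh | hb
        · filter_upwards [(isOpen_lt continuous_const continuous_fst).mem_nhds hh] with z hz hm
          exact lt_asymm hz hm.1.2
        rcases lt_or_gt_of_ne (h3 k) with hh | hy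
        · filter_upwards [(isOpen_lt continuous_snd continuous_const).mem_nhds hh] with z hz hm
          exact lt_asymm hz hm.2.1
        rcases lt_or_gt_of_ne (h4 k).symm with hh | hb'
        · filter_upwards [(isOpen_lt (hcx k) continuous_snd).mem_nhds hh] with z hz hm
          exact lt_asymm hz hm.2.2
        exact absurd ⟨⟨ha, hb⟩, hy, hb'⟩ hk
      filter_upwards [eventually_all.2 hall] with z hz
      have : ¬ ∃ k, z.1 ∈ Set.Ioo (a k) (b k) ∧ z.2 ∈ Set.Ioo (y k) (y k + θ * h k z.1) := by
        rintro ⟨k, hk⟩; exact hz k hk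
      rw [recSeq, dif_neg this]
    rw [hev.fderiv_eq]
    have hs : ∀ f : Fin (K + 1) → ℝ × ℝ → ℝ,
        ∑ k, Set.indicator {x : ℝ × ℝ | x.1 ∈ Set.Ioo (a k) (b k) ∧
        x.2 ∈ Set.Ioo (y k) (y k + θ * h k x.1)} (f k) x = 0 := by
      intro f
      refine Finset.sum_eq_zero fun k _ => ?_
      rw [Set.indicator_of_notMem]
      exact fun hm => hx ⟨k, hm⟩
    rw [hs (fun k x => - deriv (h k) x.1), hs (fun _ _ => 1 / θ)]
    simp

lemma comp_facts (Φ : (ℝ × ℝ) → (ℝ × ℝ) × (ℝ × ℝ)) (hΦ : ContDiff ℝ 1 Φ) (h1 : ∀ x, ‖Φ x‖ ≤ 1)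
    (hs : tsupport Φ ⊆ Set.Ioo (0:ℝ) 1 ×ˢ Set.Ioo (0:ℝ) 1)
    (π : (ℝ × ℝ) × (ℝ × ℝ) →L[ℝ] ℝ) (hπ : ∀ z, |π z| ≤ ‖z‖) :
    ContDiff ℝ 1 (fun x => π (Φ x)) ∧ (∀ x, |π (Φ x)| ≤ 1) ∧
      tsupport (fun x => π (Φ x)) ⊆ Set.Ioo (0:ℝ) 1 ×ˢ Set.Ioo (0:ℝ) 1 ∧
      ∃ M, ∀ x, ‖fderiv ℝ (fun x => π (Φ x)) x‖ ≤ M := by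
  have c1 : ContDiff ℝ 1 (fun x => π (Φ x)) := π.contDiff.comp hΦ
  have c3 : tsupport (fun x => π (Φ x)) ⊆ Set.Ioo (0:ℝ) 1 ×ˢ Set.Ioo (0:ℝ) 1 := by
    refine (closure_mono ?_).trans hs
    intro x hx hz
    apply hx
    simp [hz]
  refine ⟨c1, fun x => (hπ _).trans (h1 x), c3, ?_⟩
  have hcs : HasCompactSupport (fun x => π (Φ x)) := by
    refine HasCompactSupport.of_support_subset_isCompact
      (isCompact_Icc.prod isCompact_Icc : IsCompact (Set.Icc (0:ℝ) 1 ×ˢ Set.Icc (0:ℝ) 1)) ?_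
    exact (subset_tsupport _).trans (c3.trans
      (Set.prod_mono Set.Ioo_subset_Icc_self Set.Ioo_subset_Icc_self))
  exact (hcs.fderiv (𝕜 := ℝ)).exists_bound_of_continuous (c1.continuous_fderiv (by norm_num))

lemma main_bound (K : ℕ) (a b y : Fin (K + 1) → ℝ) (h : Fin (K + 1) → ℝ → ℝ) (u : ℝ × ℝ → ℝ)
    (L θ : ℝ) (hL : 0 < L) (hθ : 0 < θ) (hab : ∀ k, a k ≤ b k)
    (hsmooth : ∀ k, ContDiff ℝ 2 (h k)) (hpos : ∀ k t, 0 ≤ h k t) (hhL : ∀ k t, h k t ≤ L)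
    (hhbd : ∀ k x₁, |deriv (h k) x₁| ≤ L ∧ |deriv (deriv (h k)) x₁| ≤ L)
    (hza : ∀ k, h k (a k) = 0) (hzb : ∀ k, h k (b k) = 0)
    (huniq : ∀ (x : ℝ × ℝ) (k l : Fin (K + 1)),
      (x.1 ∈ Set.Ioo (a k) (b k) ∧ x.2 ∈ Set.Ioo (y k) (y k + θ * h k x.1)) →
      (x.1 ∈ Set.Ioo (a l) (b l) ∧ x.2 ∈ Set.Ioo (y l) (y l + θ * h l x.1)) → k = l)
    (hu : ∀ x ∈ Set.Ioo (0:ℝ) 1 ×ˢ Set.Ioo (0:ℝ) 1, (∀ k, x.2 ≠ y k) →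
      DifferentiableAt ℝ u x ∧ ‖fderiv ℝ u x‖ ≤ L ∧ DifferentiableAt ℝ (fderiv ℝ u) x ∧
      ‖fderiv ℝ (fderiv ℝ u) x‖ ≤ L) :
    secondTV (recSeq K a b y h u θ) (Set.Ioo (0:ℝ) 1 ×ˢ Set.Ioo (0:ℝ) 1) ≤
      ENNReal.ofReal (4 * (2 ^ (K + 1) * (3 * L)) +
        ∑ k, ((2 / θ + 3 * L + 2 * L * (θ * L)) * (b k - a k))) := by
  refine iSup_le ?_
  rintro ⟨Φ, hΦ, hΦ1, hΦs⟩
  refine ENNReal.ofReal_le_ofReal ?_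
  simp only
  classical
  set Y : Finset ℝ := Finset.univ.image y with hYdef
  have hY : Y.card ≤ K + 1 := Finset.card_image_le.trans (by simp)
  have hnY : ∀ s, s ∉ Y → ∀ k, s ≠ y k := by
    intro s hs k hk; exact hs (by rw [hYdef, hk]; exact Finset.mem_image_of_mem _ (Finset.mem_univ k))
  have hg : ∀ e : ℝ × ℝ, ‖e‖ ≤ 1 → ∀ x ∈ Set.Ioo (0:ℝ) 1 ×ˢ Set.Ioo (0:ℝ) 1, x.2 ∉ Y →
      DifferentiableAt ℝ (fun x => fderiv ℝ u x e) x ∧ ‖fderiv ℝ (fun x => fderiv ℝ u x e) x‖ ≤ L ∧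
      |fderiv ℝ u x e| ≤ L := by
    intro e he x hx hxY
    obtain ⟨d1, d2, d3, d4⟩ := hu x hx (hnY _ hxY)
    have hD : HasFDerivAt (fun x => fderiv ℝ u x e) ((fderiv ℝ (fderiv ℝ u) x).flip e) x := by
      have := d3.hasFDerivAt.clm_apply (hasFDerivAt_const e x)
      simpa using this
    refine ⟨hD.differentiableAt, ?_, ?_⟩
    · rw [hD.fderiv]
      refine (ContinuousLinearMap.le_opNorm _ _).trans ?_
      rw [ContinuousLinearMap.opNorm_flip]
      nlinarith [norm_nonneg e, norm_nonneg (fderiv ℝ (fderiv ℝ u) x)]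
    · rw [← Real.norm_eq_abs]
      refine (ContinuousLinearMap.le_opNorm _ _).trans ?_
      nlinarith [norm_nonneg e, norm_nonneg (fderiv ℝ u x)]
  have he1 : ‖((1, 0) : ℝ × ℝ)‖ ≤ 1 := by simp [Prod.norm_def]
  have he2 : ‖((0, 1) : ℝ × ℝ)‖ ≤ 1 := by simp [Prod.norm_def]
  have hmg : ∀ e : ℝ × ℝ, Measurable (fun x => fderiv ℝ u x e) :=
    fun e => measurable_fderiv_apply_const ℝ u e
  have hproj : ∀ z : (ℝ × ℝ) × (ℝ × ℝ), |z.1.1| ≤ ‖z‖ ∧ |z.1.2| ≤ ‖z‖ ∧ |z.2.1| ≤ ‖z‖ ∧ |z.2.2| ≤ ‖z‖ := by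
    intro z
    exact ⟨(norm_fst_le z.1).trans (norm_fst_le z), (norm_snd_le z.1).trans (norm_fst_le z),
      (norm_fst_le z.2).trans (norm_snd_le z), (norm_snd_le z.2).trans (norm_snd_le z)⟩
  obtain ⟨c11, b11, s11, M11, m11⟩ := comp_facts Φ hΦ hΦ1 hΦs
    ((ContinuousLinearMap.fst ℝ ℝ ℝ).comp (ContinuousLinearMap.fst ℝ (ℝ × ℝ) (ℝ × ℝ)))
    (fun z => (hproj z).1)
  obtain ⟨c12, b12, s12, M12, m12⟩ := comp_facts Φ hΦ hΦ1 hΦs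
    ((ContinuousLinearMap.snd ℝ ℝ ℝ).comp (ContinuousLinearMap.fst ℝ (ℝ × ℝ) (ℝ × ℝ)))
    (fun z => (hproj z).2.1)
  obtain ⟨c21, b21, s21, M21, m21⟩ := comp_facts Φ hΦ hΦ1 hΦs
    ((ContinuousLinearMap.fst ℝ ℝ ℝ).comp (ContinuousLinearMap.snd ℝ (ℝ × ℝ) (ℝ × ℝ)))
    (fun z => (hproj z).2.2.1)
  obtain ⟨c22, b22, s22, M22, m22⟩ := comp_facts Φ hΦ hΦ1 hΦs
    ((ContinuousLinearMap.snd ℝ ℝ ℝ).comp (ContinuousLinearMap.snd ℝ (ℝ × ℝ) (ℝ × ℝ)))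
    (fun z => (hproj z).2.2.2)
  simp only [ContinuousLinearMap.comp_apply, ContinuousLinearMap.coe_fst',
    ContinuousLinearMap.coe_snd'] at c11 b11 s11 m11 c12 b12 s12 m12 c21 b21 s21 m21 c22 b22 s22 m22
  -- the strip data
  have hh1 : ∀ k, ContDiff ℝ 1 (h k) := fun k => (hsmooth k).of_le (by norm_num)
  have hh' : ∀ k, ContDiff ℝ 1 (deriv (h k)) := fun k =>
    ((contDiff_succ_iff_deriv (n := 1)).1 (by simpa [one_add_one_eq_two] using hsmooth k)).2.2
  have hw : ∀ k, ContDiff ℝ 1 (fun t => θ * h k t) := fun k => contDiff_const.mul (hh1 k)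
  have hwc : ∀ k, Continuous (fun t => θ * h k t) := fun k => (hw k).continuous
  have hw0 : ∀ k t, 0 ≤ θ * h k t := fun k t => mul_nonneg hθ.le (hpos k t)
  have hwW : ∀ k t, θ * h k t ≤ θ * L := fun k t => mul_le_mul_of_nonneg_left (hhL k t) hθ.le
  have hwW' : ∀ k t, |deriv (fun t => θ * h k t) t| ≤ θ * L := by
    intro k t
    rw [deriv_const_mul _ ((hh1 k).differentiable (by norm_num) t), abs_mul, abs_of_pos hθ]
    exact mul_le_mul_of_nonneg_left (hhbd k t).1 hθ.le
  have hF1 : ∀ k, ContDiff ℝ 1 (fun t => - deriv (h k) t) := fun k => (hh' k).neg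
  have hF1b : ∀ k t, |- deriv (h k) t| ≤ L := fun k t => by rw [abs_neg]; exact (hhbd k t).1
  have hF1b' : ∀ k t, |deriv (fun t => - deriv (h k) t) t| ≤ L := fun k t => by
    rw [deriv.fun_neg, abs_neg]; exact (hhbd k t).2
  have hF2 : ∀ k : Fin (K + 1), ContDiff ℝ 1 (fun _ : ℝ => 1 / θ) := fun k => contDiff_const
  have hF2b : ∀ (k : Fin (K + 1)) (t : ℝ), |(fun _ : ℝ => 1 / θ) t| ≤ 1 / θ := fun k t => by
    simp [abs_of_pos hθ]
  have hF2b' : ∀ (t : ℝ), |deriv (fun _ : ℝ => 1 / θ) t| ≤ 0 := fun t => by simp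
  have h3L : 3 * L ≤ 2 ^ (K + 1) * (3 * L) := by
    have : (1:ℝ) ≤ 2 ^ (K + 1) := one_le_pow₀ (by norm_num)
    nlinarith
  obtain ⟨i11, B11⟩ := block K a b y (fun k t => θ * h k t) (fun k t => - deriv (h k) t)
    (fun x => fderiv ℝ u x (1, 0)) _ L M11 L _ hL.le Y (1, 0) (Or.inl rfl) _ (hmg _) m11
    (fun x hx hy => (hg _ he1 x hx hy).2.2) hwc (fun k => (hF1 k).continuous) hF1b
    ((u_part1 _ _ L M11 hL.le Y (hmg _) c11 b11 m11 (hg _ he1)).trans h3L)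
    (fun k => strip1 (a k) (b k) (y k) (hab k) _ _ _ M11 L L _ _ (hw k) (hw0 k)
      (by simp [hza]) (by simp [hzb]) (hwW k) (hwW' k) (hF1 k) (hF1b k) (hF1b' k) c11 b11 m11 s11)
  obtain ⟨i12, B12⟩ := block K a b y (fun k t => θ * h k t) (fun k t => - deriv (h k) t)
    (fun x => fderiv ℝ u x (1, 0)) _ L M12 L _ hL.le Y (0, 1) (Or.inr rfl) _ (hmg _) m12
    (fun x hx hy => (hg _ he1 x hx hy).2.2) hwc (fun k => (hF1 k).continuous) hF1b
    (u_part2 _ _ L M12 hL.le (K + 1) Y hY (hmg _) c12 b12 m12 (hg _ he1))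
    (fun k => strip2 (a k) (b k) (y k) (hab k) _ _ _ M12 L (hwc k) (hw0 k)
      (hF1 k).continuous (hF1b k) c12 b12 m12 s12)
  obtain ⟨i21, B21⟩ := block K a b y (fun k t => θ * h k t) (fun _ _ => 1 / θ)
    (fun x => fderiv ℝ u x (0, 1)) _ L M21 (1 / θ) _ hL.le Y (1, 0) (Or.inl rfl) _ (hmg _) m21
    (fun x hx hy => (hg _ he2 x hx hy).2.2) hwc (fun k => (hF2 k).continuous) hF2b
    ((u_part1 _ _ L M21 hL.le Y (hmg _) c21 b21 m21 (hg _ he2)).trans h3L)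
    (fun k => strip1 (a k) (b k) (y k) (hab k) _ _ _ M21 (1 / θ) 0 _ _ (hw k) (hw0 k)
      (by simp [hza]) (by simp [hzb]) (hwW k) (hwW' k) (hF2 k) (hF2b k) hF2b' c21 b21 m21 s21)
  obtain ⟨i22, B22⟩ := block K a b y (fun k t => θ * h k t) (fun _ _ => 1 / θ)
    (fun x => fderiv ℝ u x (0, 1)) _ L M22 (1 / θ) _ hL.le Y (0, 1) (Or.inr rfl) _ (hmg _) m22
    (fun x hx hy => (hg _ he2 x hx hy).2.2) hwc (fun k => (hF2 k).continuous) hF2b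
    (u_part2 _ _ L M22 hL.le (K + 1) Y hY (hmg _) c22 b22 m22 (hg _ he2))
    (fun k => strip2 (a k) (b k) (y k) (hab k) _ _ _ M22 (1 / θ) (hwc k) (hw0 k)
      (hF2 k).continuous (hF2b k) c22 b22 m22 s22)
  have hsum := add_le_add (add_le_add B11 B12) (add_le_add B21 B22)
  rw [← integral_add' i11 i12, ← integral_add' i21 i22,
    ← integral_add' (i11.add i12) (i21.add i22)] at hsum
  refine (le_of_eq ?_).trans (hsum.trans (le_of_eq ?_))
  · refine integral_congr_ae ?_
    have n1 : ∀ᵐ x : ℝ × ℝ, ∀ k, x.1 ≠ a k := ae_all_iff.2 fun k => vline_null _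
    have n2 : ∀ᵐ x : ℝ × ℝ, ∀ k, x.1 ≠ b k := ae_all_iff.2 fun k => vline_null _
    have n3 : ∀ᵐ x : ℝ × ℝ, ∀ k, x.2 ≠ y k := ae_all_iff.2 fun k => hline_null _
    have n4 : ∀ᵐ x : ℝ × ℝ, ∀ k, x.2 ≠ y k + θ * h k x.1 := ae_all_iff.2 fun k =>
      graph_null (fun t => y k + θ * h k t) (continuous_const.add (hwc k))
    filter_upwards [ae_restrict_of_ae n1, ae_restrict_of_ae n2, ae_restrict_of_ae n3,
      ae_restrict_of_ae n4, ae_restrict_mem (measurableSet_Ioo.prod measurableSet_Ioo)]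
      with x q1 q2 q3 q4 hx
    obtain ⟨g1, g2⟩ := rec_grad K a b y h u θ hh1 huniq x (hu x hx q3).1 q1 q2 q3 q4
    rw [g1, g2]
    simp only [Pi.add_apply]
    ring
  · have : ∀ k, (2 / θ + 3 * L + 2 * L * (θ * L)) * (b k - a k) =
        (L * (θ * L) + L * (θ * L)) * (b k - a k) + L * 2 * (b k - a k) +
        ((0 * (θ * L) + 1 / θ * (θ * L)) * (b k - a k) + 1 / θ * 2 * (b k - a k)) := by
      intro k; field_simp; ring
    simp only [this, Finset.sum_add_distrib]
    ring

/-- Interface length of the recovery sequence: in the setting of the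
recovery-sequence construction, with `ℋ¹(J_u) = Σ_k (b_k - a_k)`,
`σθ|D²u_θ|((0,1)²) ≤ 2σ(1+cθ)ℋ¹(J_u) + cσθ`; in particular
`limsup_{θ→0⁺} σθ|D²u_θ|((0,1)²) ≤ 2σℋ¹(J_u)`. -/
theorem stmt18 (p ρ L σ : ℝ) (K : ℕ) (a b y : Fin (K + 1) → ℝ)
    (Hsup : Fin (K + 1) → ℝ) (h : Fin (K + 1) → ℝ → ℝ) (u : ℝ × ℝ → ℝ)
    (hp : 1 < p) (hρ : 0 < ρ) (hL : 0 < L) (hσ : 0 < σ)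
    (hgeom : ∀ k, 0 < a k ∧ a k < b k ∧ b k < 1 ∧ 0 < y k ∧ y k < 1)
    (hsep : ∀ k l, k ≠ l → ∀ x₁ ∈ Set.Icc (a k) (b k), ∀ x₁' ∈ Set.Icc (a l) (b l),
      2 * ρ < dist ((x₁, y k) : ℝ × ℝ) ((x₁', y l) : ℝ × ℝ))
    (hsmooth : ∀ k, ContDiff ℝ (⊤ : ℕ∞) (h k))
    (hpos : ∀ k x₁, 0 ≤ h k x₁)
    (hHsup : ∀ k x₁, |h k x₁| ≤ Hsup k) (hHsupL : ∀ k, Hsup k ≤ L)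
    (husmooth : ContDiffOn ℝ (⊤ : ℕ∞) u
      ((Set.Ioo (0:ℝ) 1 ×ˢ Set.Ioo (0:ℝ) 1) \
        {x : ℝ × ℝ | ∃ k, x.1 ∈ Set.Icc (a k) (b k) ∧ x.2 = y k}))
    (hubd : ∀ x ∈ (Set.Ioo (0:ℝ) 1 ×ˢ Set.Ioo (0:ℝ) 1) \
        {x : ℝ × ℝ | ∃ k, x.1 ∈ Set.Icc (a k) (b k) ∧ x.2 = y k},
      ‖fderiv ℝ u x‖ ≤ L)
    (hu2bd : ∀ x ∈ (Set.Ioo (0:ℝ) 1 ×ˢ Set.Ioo (0:ℝ) 1) \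
        {x : ℝ × ℝ | ∃ k, x.1 ∈ Set.Icc (a k) (b k) ∧ x.2 = y k},
      ‖fderiv ℝ (fderiv ℝ u) x‖ ≤ L)
    (hhbd : ∀ k x₁, |deriv (h k) x₁| ≤ L ∧ |deriv (deriv (h k)) x₁| ≤ L)
    (hjump : ∀ k, ∀ x₁ ∈ Set.Ioo (a k) (b k),
      Tendsto (fun t : ℝ => u (x₁, y k + t) - u (x₁, y k - t))
        (nhdsWithin 0 (Set.Ioi 0)) (nhds (h k x₁))) :
    ∃ c : ℝ, 0 < c ∧
      (∀ θ : ℝ, 0 < θ → θ * L ≤ ρ →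
        ENNReal.ofReal (σ * θ) *
            secondTV (recSeq K a b y h u θ) (Set.Ioo (0:ℝ) 1 ×ˢ Set.Ioo (0:ℝ) 1)
          ≤ ENNReal.ofReal
              (2 * σ * (1 + c * θ) * (∑ k, (b k - a k)) + c * σ * θ))
      ∧ Filter.limsup
          (fun θ : ℝ => ENNReal.ofReal (σ * θ) *
            secondTV (recSeq K a b y h u θ) (Set.Ioo (0:ℝ) 1 ×ˢ Set.Ioo (0:ℝ) 1))
          (nhdsWithin 0 (Set.Ioi 0))
        ≤ ENNReal.ofReal (2 * σ * (∑ k, (b k - a k))) := by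
  have hhL : ∀ k t, h k t ≤ L := fun k t => (le_abs_self _).trans ((hHsup k t).trans (hHsupL k))
  set S : Set (ℝ × ℝ) := {x : ℝ × ℝ | ∃ k, x.1 ∈ Set.Icc (a k) (b k) ∧ x.2 = y k} with hS
  set Ω : Set (ℝ × ℝ) := Set.Ioo (0:ℝ) 1 ×ˢ Set.Ioo (0:ℝ) 1 with hΩ
  have hSc : IsClosed S := by
    have : S = ⋃ k, (Set.Icc (a k) (b k) ×ˢ {y k}) := by
      ext x; simp [hS, Set.mem_prod]
    rw [this]
    exact isClosed_iUnion_of_finite fun k => isClosed_Icc.prod isClosed_singleton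
  have hΩo : IsOpen Ω := isOpen_Ioo.prod isOpen_Ioo
  have hUo : IsOpen (Ω \ S) := hΩo.sdiff hSc
  have hcd : ∀ x ∈ Ω \ S, ContDiffAt ℝ (⊤ : ℕ∞) u x := fun x hx =>
    husmooth.contDiffAt (hUo.mem_nhds hx)
  have hd1 : ∀ x ∈ Ω \ S, DifferentiableAt ℝ u x := fun x hx =>
    (hcd x hx).differentiableAt (by simp)
  have hd2 : ∀ x ∈ Ω \ S, DifferentiableAt ℝ (fderiv ℝ u) x := fun x hx =>
    ((hcd x hx).fderiv_right (m := 1) (by rw [one_add_one_eq_two]; exact WithTop.coe_le_coe.2 le_top)).differentiableAt (by simp)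
  -- endpoints
  have hend : ∀ k c e, ((c = a k ∧ e = (1:ℝ)) ∨ (c = b k ∧ e = -1)) → h k c = 0 := by
    intro k c e hc
    obtain ⟨g1, g2, g3, g4, g5⟩ := hgeom k
    have hcI : c ∈ Set.Icc (a k) (b k) := by
      rcases hc with ⟨rfl, _⟩ | ⟨rfl, _⟩
      · exact ⟨le_rfl, g2.le⟩
      · exact ⟨g2.le, le_rfl⟩
    have hcΩ : ((c, y k) : ℝ × ℝ) ∈ Ω := ⟨⟨g1.trans_le hcI.1, hcI.2.trans_lt g3⟩, ⟨g4, g5⟩⟩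
    obtain ⟨r, hr, hball⟩ := Metric.isOpen_iff.1 hΩo _ hcΩ
    refine tip_zero u (h k) (hsmooth k).continuous (a k) (b k) (y k) c (min r (2 * ρ)) L e
      (lt_min hr (by linarith)) g2 hc ?_ (hjump k)
    intro x hx1 hx2 hx3
    have hxU : x ∈ Ω \ S := by
      refine ⟨hball ?_, ?_⟩
      · rw [Metric.mem_ball, Prod.dist_eq, Real.dist_eq, Real.dist_eq]
        exact max_lt (hx1.trans_le (min_le_left _ _)) (hx2.trans_le (min_le_left _ _))
      · rintro ⟨l, hl1, hl2⟩
        by_cases hkl : l = k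
        · subst hkl; exact hx3 ⟨hl1, hl2⟩
        · have := hsep l k hkl x.1 hl1 c hcI
          rw [← hl2, Prod.dist_eq, Real.dist_eq, Real.dist_eq] at this
          exact lt_asymm this
            (max_lt (hx1.trans_le (min_le_right _ _)) (hx2.trans_le (min_le_right _ _)))
    exact ⟨hd1 x hxU, hubd x hxU⟩
  have hTV : ∀ θ : ℝ, 0 < θ → θ * L ≤ ρ → secondTV (recSeq K a b y h u θ) Ω ≤
      ENNReal.ofReal (4 * (2 ^ (K + 1) * (3 * L)) +
        ∑ k, ((2 / θ + 3 * L + 2 * L * (θ * L)) * (b k - a k))) := by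
    intro θ hθ hθL
    refine main_bound K a b y h u L θ hL hθ (fun k => (hgeom k).2.1.le)
      (fun k => (hsmooth k).of_le (WithTop.coe_le_coe.2 (le_top : (2:ℕ∞) ≤ ⊤))) hpos hhL hhbd
      (fun k => hend k _ 1 (Or.inl ⟨rfl, rfl⟩)) (fun k => hend k _ (-1) (Or.inr ⟨rfl, rfl⟩))
      (fun x k l hk hl => seg_uniq K a b y ρ L h hsep hρ hhL θ hθ hθL x k l hk hl) ?_
    intro x hx hxy
    have hxU : x ∈ Ω \ S := ⟨hx, fun ⟨k, _, hk⟩ => hxy k hk⟩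
    exact ⟨hd1 x hxU, hubd x hxU, hd2 x hxU, hu2bd x hxU⟩
  set s : ℝ := ∑ k, (b k - a k) with hs
  have hs0 : 0 ≤ s := Finset.sum_nonneg fun k _ => sub_nonneg.2 (hgeom k).2.1.le
  set C : ℝ := 4 * (2 ^ (K + 1) * (3 * L)) + (3 * L + 2 * L * ρ) * s with hC
  have hC0 : 0 < C := by positivity
  have main : ∀ θ : ℝ, 0 < θ → θ * L ≤ ρ →
      ENNReal.ofReal (σ * θ) * secondTV (recSeq K a b y h u θ) Ω
        ≤ ENNReal.ofReal (2 * σ * (1 + C * θ) * s + C * σ * θ) := by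
    intro θ hθ hθL
    refine (mul_le_mul_right (hTV θ hθ hθL) _).trans ?_
    rw [← ENNReal.ofReal_mul (by positivity)]
    refine ENNReal.ofReal_le_ofReal ?_
    rw [← Finset.mul_sum, ← hs]
    have e1 : σ * θ * (4 * (2 ^ (K + 1) * (3 * L)) + (2 / θ + 3 * L + 2 * L * (θ * L)) * s) =
        2 * σ * s + σ * θ * (4 * (2 ^ (K + 1) * (3 * L)) + (3 * L + 2 * L * (θ * L)) * s) := by
      field_simp; ring
    rw [e1]
    have e2 : (3 * L + 2 * L * (θ * L)) * s ≤ (3 * L + 2 * L * ρ) * s := by gcongr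
    have e3 : σ * θ * (4 * (2 ^ (K + 1) * (3 * L)) + (3 * L + 2 * L * (θ * L)) * s) ≤ σ * θ * C := by
      refine mul_le_mul_of_nonneg_left ?_ (by positivity)
      rw [hC]; linarith
    have e4 : 0 ≤ 2 * σ * (C * θ) * s := by positivity
    nlinarith
  refine ⟨C, hC0, main, ?_⟩
  have hlim : Tendsto (fun θ : ℝ => ENNReal.ofReal (2 * σ * (1 + C * θ) * s + C * σ * θ))
      (𝓝[>] 0) (𝓝 (ENNReal.ofReal (2 * σ * s))) := by
    have : Continuous (fun θ : ℝ => ENNReal.ofReal (2 * σ * (1 + C * θ) * s + C * σ * θ)) :=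
      ENNReal.continuous_ofReal.comp (by fun_prop)
    have := (this.tendsto 0).mono_left (nhdsWithin_le_nhds (s := Set.Ioi 0))
    simpa using this
  rw [← hlim.limsup_eq]
  refine limsup_le_limsup ?_
  filter_upwards [Ioo_mem_nhdsGT (div_pos hρ hL)] with θ hθ
  exact main θ hθ.1 ((lt_div_iff₀ hL).1 hθ.2).le
end
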